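/- arXiv:2507.23583 — 2 statements merged into one kernel-verified Lean document; each statement's English description precedes it below -/
import Mathlib

section
/- Let k ≥ 1 be an integer, 0 < T < ∞ and B ≥ 0. Let h : (0,1] × (0,T] → ℝ be C^∞ (all partial derivatives exist and are continuous up to r = 1 and t = T), with |h(r,t)| ≤ B for all (r,t), satisfying ∂_t h = ∂_r² h + ∂_r h/r − k²·sin(2h)/(2r²) on (0,1) × (0,T). Then for each n ∈ {0,1,2} there exists a constant C > 0 (depending on k, n, B, T and h) such that |∂_r^n h(r,t)| ≤ C·r^{−n} for all r ∈ (0,1] and all t ∈ [T/2,T]. -/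
open Real Set

/-- Partial derivative in the radial variable `r` of `h(r,t)`. -/
noncomputable def pdr (h : ℝ × ℝ → ℝ) (p : ℝ × ℝ) : ℝ :=
  deriv (fun r => h (r, p.2)) p.1

/-- Second partial derivative in `r` of `h(r,t)`. -/
noncomputable def pdrr (h : ℝ × ℝ → ℝ) (p : ℝ × ℝ) : ℝ :=
  deriv (fun r => pdr h (r, p.2)) p.1

/-- Partial derivative in the time variable `t` of `h(r,t)`. -/
noncomputable def pdt (h : ℝ × ℝ → ℝ) (p : ℝ × ℝ) : ℝ :=
  deriv (fun t => h (p.1, t)) p.2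


lemma aux_snd {g g' : ℝ → ℝ} {x c : ℝ} (hg : ∀ᶠ y in nhds x, HasDerivAt g (g' y) y)
    (hc : HasDerivAt g' c x) (hm : IsLocalMax g x) : c ≤ 0 := by
  by_contra hcon
  push Not at hcon
  have h1 : deriv g =ᶠ[nhds x] g' := hg.mono fun y hy => hy.deriv
  have hd : deriv g x = 0 := hm.deriv_eq_zero
  have h2 : deriv (deriv g) x = c := by rw [h1.deriv_eq]; exact hc.deriv
  have hmin : IsLocalMin g x := isLocalMin_of_deriv_deriv_pos (by rw [h2]; exact hcon) hd
    (hg.self_of_nhds.continuousAt)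
  have heq : g =ᶠ[nhds x] fun _ => g x := by
    filter_upwards [hm, hmin] with y h3 h4 using le_antisymm h3 h4
  have h5 : deriv g =ᶠ[nhds x] fun _ => 0 := by
    have := heq.deriv
    simpa using this
  have h6 : deriv (deriv g) x = 0 := by rw [h5.deriv_eq]; simp
  linarith

lemma aux_time {g : ℝ → ℝ} {a x c : ℝ} (hax : a < x) (hc : HasDerivAt g c x)
    (hm : ∀ y ∈ Icc a x, g y ≤ g x) : 0 ≤ c := by
  have h1 : HasDerivWithinAt g c (Iio x) x := hc.hasDerivWithinAt
  have h2 := hasDerivWithinAt_iff_tendsto_slope' (by simp) |>.1 h1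
  refine ge_of_tendsto h2 ?_
  filter_upwards [Ioo_mem_nhdsLT hax] with y hy
  rw [slope_def_field]
  apply div_nonneg_of_nonpos
  · have := hm y ⟨hy.1.le, hy.2.le⟩; linarith
  · linarith [hy.2]

set_option maxHeartbeats 2000000 in
lemma aux_alg {A M K ρ f fx fxx ft v p px pxx pt vt G1 G2 l : ℝ} (hA : 0 ≤ A) (hM : 0 ≤ M)
    (hK : 0 ≤ K)
    (hρ0 : 0 ≤ ρ) (hρ1 : ρ ≤ 1) (hf : |f| ≤ K) (hfx : |fx| ≤ K) (hfxx : |fxx| ≤ K)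
    (hft : |ft| ≤ K) (hv : |v| ≤ M) (hG1 : |G1| ≤ A * (1 + |p|))
    (hG2 : |G2| ≤ A * (1 + |p| + |px|)) (e1 : ρ * vt = px + G1) (e2 : ρ * pt = pxx + G2)
    (hl : l = 20 * K ^ 2 + K ^ 2 * (3 * A + A ^ 2) + 1)
    (h1 : 0 ≤ 2 * f * ft * p ^ 2 + 2 * f ^ 2 * p * pt + 2 * l * v * vt)
    (h2 : 2 * fx ^ 2 * p ^ 2 + 2 * f * fxx * p ^ 2 + 8 * f * fx * p * px + 2 * f ^ 2 * px ^ 2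
      + 2 * f ^ 2 * p * pxx + 2 * l * p ^ 2 + 2 * l * v * px ≤ 0) :
    p ^ 2 ≤ K ^ 2 * A + l * (2 * M * A + M ^ 2 * A ^ 2) := by
  have hl0 : 0 ≤ l := by rw [hl]; positivity
  have key : 0 ≤ 2 * ρ * (f * ft) * p ^ 2 + 2 * f ^ 2 * (p * G2) + 2 * l * (v * G1)
      - 2 * fx ^ 2 * p ^ 2 - 2 * (f * fxx) * p ^ 2 - 8 * f * fx * p * px - 2 * f ^ 2 * px ^ 2
      - 2 * l * p ^ 2 := by
    have h3 := mul_nonneg hρ0 h1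
    have : ρ * (2 * f * ft * p ^ 2 + 2 * f ^ 2 * p * pt + 2 * l * v * vt)
      = 2 * ρ * (f * ft) * p ^ 2 + 2 * f ^ 2 * p * (ρ * pt) + 2 * l * v * (ρ * vt) := by ring
    rw [this, e1, e2] at h3
    linarith
  have hff : f ^ 2 ≤ K ^ 2 := sq_le_sq' (abs_le.1 hf).1 (abs_le.1 hf).2
  have hfx2 : fx ^ 2 ≤ K ^ 2 := sq_le_sq' (abs_le.1 hfx).1 (abs_le.1 hfx).2
  have b1 : 2 * ρ * (f * ft) * p ^ 2 ≤ 2 * K ^ 2 * p ^ 2 := by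
    have : |f * ft| ≤ K ^ 2 := by rw [abs_mul, sq]; gcongr
    have h4 : ρ * (f * ft) ≤ 1 * K ^ 2 :=
      (mul_le_mul_of_nonneg_left ((le_abs_self _).trans this) hρ0).trans (by gcongr)
    nlinarith [mul_le_mul_of_nonneg_right h4 (sq_nonneg p)]
  have b2 : - 2 * (f * fxx) * p ^ 2 ≤ 2 * K ^ 2 * p ^ 2 := by
    have : |f * fxx| ≤ K ^ 2 := by rw [abs_mul, sq]; gcongr
    nlinarith [mul_le_mul_of_nonneg_right (abs_le.1 this).1 (sq_nonneg p)]
  have b3 : - 8 * f * fx * p * px ≤ f ^ 2 * px ^ 2 + 16 * K ^ 2 * p ^ 2 := by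
    nlinarith [sq_nonneg (f * px + 4 * fx * p), mul_le_mul_of_nonneg_right hfx2 (sq_nonneg p)]
  have b4 : 2 * f ^ 2 * (p * G2) ≤ f ^ 2 * px ^ 2 + K ^ 2 * (A + 3 * A * p ^ 2 + A ^ 2 * p ^ 2) := by
    have q1 : p * G2 ≤ |p| * (A * (1 + |p| + |px|)) := by
      refine (le_abs_self _).trans ?_
      rw [abs_mul]; gcongr
    have q2 : 2 * (p * G2) ≤ px ^ 2 + (A + 3 * A * p ^ 2 + A ^ 2 * p ^ 2) := by
      have := sq_abs p
      have := sq_abs px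
      nlinarith [sq_nonneg (|px| - A * |p|), mul_nonneg hA (sq_nonneg (|p| - 1))]
    have q3 := mul_le_mul_of_nonneg_left q2 (sq_nonneg f)
    have q4 : 0 ≤ A + 3 * A * p ^ 2 + A ^ 2 * p ^ 2 := by positivity
    have q5 := mul_le_mul_of_nonneg_right hff q4
    linarith
  have b5 : 2 * l * (v * G1) ≤ l * (2 * M * A + M ^ 2 * A ^ 2 + p ^ 2) := by
    have q1 : v * G1 ≤ M * (A * (1 + |p|)) := by
      refine (le_abs_self _).trans ?_
      rw [abs_mul]; gcongr
    have q2 : 2 * (v * G1) ≤ 2 * M * A + M ^ 2 * A ^ 2 + p ^ 2 := by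
      have := sq_abs p
      nlinarith [sq_nonneg (M * A - |p|)]
    have q3 := mul_le_mul_of_nonneg_left q2 hl0
    linarith
  have hx0 : 0 ≤ fx ^ 2 * p ^ 2 := by positivity
  have hlp : l * p ^ 2 = 20 * K ^ 2 * p ^ 2 + K ^ 2 * (3 * A + A ^ 2) * p ^ 2 + p ^ 2 := by
    rw [hl]; ring
  linarith

set_option maxHeartbeats 2000000 in
lemma bernstein_est (A M τ : ℝ) (hA : 0 ≤ A) (hM : 0 ≤ M) (hτ : 0 < τ) :
    ∃ C : ℝ, 0 ≤ C ∧ ∀ (x0 t0 t1 : ℝ) (v p vt px pxx pt ρ : ℝ × ℝ → ℝ), t0 ≤ t1 → t1 ≤ t0 + τ →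
      ContinuousOn v (Icc (x0 - 1) (x0 + 1) ×ˢ Icc t0 t1) →
      ContinuousOn p (Icc (x0 - 1) (x0 + 1) ×ˢ Icc t0 t1) →
      (∀ x ∈ Icc (x0 - 1) (x0 + 1), ∀ t ∈ Icc t0 t1,
        HasDerivAt (fun y => v (y, t)) (p (x, t)) x ∧
        HasDerivAt (fun y => p (y, t)) (px (x, t)) x ∧
        HasDerivAt (fun y => px (y, t)) (pxx (x, t)) x ∧
        HasDerivAt (fun s => v (x, s)) (vt (x, t)) t ∧
        HasDerivAt (fun s => p (x, s)) (pt (x, t)) t ∧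
        |v (x, t)| ≤ M ∧ 0 ≤ ρ (x, t) ∧ ρ (x, t) ≤ 1 ∧
        |ρ (x, t) * vt (x, t) - px (x, t)| ≤ A * (1 + |p (x, t)|) ∧
        |ρ (x, t) * pt (x, t) - pxx (x, t)| ≤ A * (1 + |p (x, t)| + |px (x, t)|)) →
      (t1 - t0) ^ 2 * p (x0, t1) ^ 2 ≤ C := by
  set K := 2 * τ + 1 with hK
  set l := 20 * K ^ 2 + K ^ 2 * (3 * A + A ^ 2) + 1 with hl
  have hK0 : 0 ≤ K := by positivity
  have hl0 : 0 ≤ l := by positivity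
  refine ⟨K ^ 2 * (K ^ 2 * A + l * (2 * M * A + M ^ 2 * A ^ 2)) + l * M ^ 2, by positivity, ?_⟩
  intro x0 t0 t1 v p vt px pxx pt ρ h01 h1τ cv cp H
  set φ : ℝ × ℝ → ℝ := fun z => (1 - (z.1 - x0) ^ 2) * (z.2 - t0) with hφ
  set W : ℝ × ℝ → ℝ := fun z => φ z ^ 2 * p z ^ 2 + l * v z ^ 2 with hW
  have cφ : Continuous φ := by rw [hφ]; fun_prop
  have cW : ContinuousOn W (Icc (x0 - 1) (x0 + 1) ×ˢ Icc t0 t1) := by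
    rw [hW]
    exact ((cφ.continuousOn.pow 2).mul (cp.pow 2)).add (continuousOn_const.mul (cv.pow 2))
  have hmem : (x0, t1) ∈ Icc (x0 - 1) (x0 + 1) ×ˢ Icc t0 t1 :=
    ⟨⟨by simp, by simp⟩, ⟨h01, le_rfl⟩⟩
  obtain ⟨⟨x, t⟩, ⟨hx, ht⟩, hmax⟩ :=
    (isCompact_Icc.prod isCompact_Icc).exists_isMaxOn ⟨_, hmem⟩ cW
  simp only at hx ht
  have hmax' : ∀ y ∈ Icc (x0 - 1) (x0 + 1), ∀ s ∈ Icc t0 t1, W (y, s) ≤ W (x, t) :=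
    fun y hy s hs => hmax (show (y, s) ∈ _ from ⟨hy, hs⟩)
  have hfin : (t1 - t0) ^ 2 * p (x0, t1) ^ 2 ≤ W (x, t) := by
    have h1 := hmax' x0 hmem.1 t1 hmem.2
    have h2 : W (x0, t1) = (t1 - t0) ^ 2 * p (x0, t1) ^ 2 + l * v (x0, t1) ^ 2 := by
      simp [hW, hφ]
    have : 0 ≤ l * v (x0, t1) ^ 2 := by positivity
    linarith
  refine hfin.trans ?_
  obtain ⟨-, -, -, -, -, hvM, -⟩ := H x hx t ht
  have hv2 : v (x, t) ^ 2 ≤ M ^ 2 := sq_le_sq' (abs_le.1 hvM).1 (abs_le.1 hvM).2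
  have hlv : l * v (x, t) ^ 2 ≤ l * M ^ 2 := by gcongr
  by_cases h0 : φ (x, t) = 0
  · have : W (x, t) = l * v (x, t) ^ 2 := by simp [hW, h0]
    rw [this]
    have : 0 ≤ K ^ 2 * (K ^ 2 * A + l * (2 * M * A + M ^ 2 * A ^ 2)) := by positivity
    linarith
  have hxl : x0 - 1 < x := lt_of_le_of_ne hx.1 (by
    rintro rfl; apply h0; simp [hφ])
  have hxr : x < x0 + 1 := lt_of_le_of_ne hx.2 (by
    rintro rfl; apply h0; simp [hφ])
  have htl : t0 < t := lt_of_le_of_ne ht.1 (by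
    rintro rfl; apply h0; simp [hφ])
  -- derivatives
  have dφx : ∀ y s, HasDerivAt (fun y => φ (y, s)) (-2 * (y - x0) * (s - t0)) y := by
    intro y s
    have := (((((hasDerivAt_id y).sub_const x0).pow 2).const_sub 1).mul_const (s - t0))
    refine this.congr_deriv ?_
    simp
  have dφxx : ∀ y s, HasDerivAt (fun y => -2 * (y - x0) * (s - t0)) (-2 * (s - t0)) y := by
    intro y s
    have := ((((hasDerivAt_id y).sub_const x0).const_mul (-2)).mul_const (s - t0))
    refine this.congr_deriv ?_
    simp
  have dφt : ∀ y s, HasDerivAt (fun s => φ (y, s)) (1 - (y - x0) ^ 2) s := by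
    intro y s
    have := ((hasDerivAt_id s).sub_const t0).const_mul (1 - (y - x0) ^ 2)
    refine this.congr_deriv ?_
    simp
  have dWx : ∀ y ∈ Icc (x0 - 1) (x0 + 1), HasDerivAt (fun y => W (y, t))
      (2 * φ (y, t) * (-2 * (y - x0) * (t - t0)) * p (y, t) ^ 2
        + 2 * φ (y, t) ^ 2 * p (y, t) * px (y, t) + 2 * l * v (y, t) * p (y, t)) y := by
    intro y hy
    obtain ⟨d1, d2, -⟩ := H y hy t ht
    have := (((dφx y t).pow 2).mul (d2.pow 2)).add ((d1.pow 2).const_mul l)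
    refine this.congr_deriv ?_
    simp; ring
  obtain ⟨d1, d2, d3, d4, d5, -, hρ0, hρ1, hG1, hG2⟩ := H x hx t ht
  have dWxx := ((((dφx x t).mul (dφxx x t)).const_mul 2).mul (d2.pow 2)).add
    ((((((dφx x t).pow 2).const_mul 2).mul d2).mul d3).add (((d1.const_mul (2 * l))).mul d2))
  have dWt := (((dφt x t).pow 2).mul (d5.pow 2)).add ((d4.pow 2).const_mul l)
  have hWt := aux_time (g := fun s => W (x, s)) htl dWt
    (fun s hs => hmax' x hx s ⟨hs.1, hs.2.trans ht.2⟩)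
  have hnhds : Icc (x0 - 1) (x0 + 1) ∈ nhds x := Icc_mem_nhds hxl hxr
  have hWxx := aux_snd (g := fun y => W (y, t)) (g' := fun y =>
        (2 * φ (y, t) * (-2 * (y - x0) * (t - t0)) * p (y, t) ^ 2
        + 2 * φ (y, t) ^ 2 * p (y, t) * px (y, t) + 2 * l * v (y, t) * p (y, t)))
      (by filter_upwards [hnhds] with y hy using dWx y hy)
      (dWxx.congr_of_eventuallyEq (Filter.Eventually.of_forall (fun y => by
        simp; ring)))
      (by filter_upwards [hnhds] with y hy using hmax' y hy t ht)
  have htt : 0 ≤ t - t0 := by linarith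
  have htτ : t - t0 ≤ τ := by linarith [ht.2]
  have hxa : |x - x0| ≤ 1 := by rw [abs_le]; constructor <;> linarith
  have hx2 : (x - x0) ^ 2 ≤ 1 := by rw [← sq_abs]; nlinarith [abs_nonneg (x - x0)]
  have k1 : |φ (x, t)| ≤ K := by
    have j1 : 0 ≤ 1 - (x - x0) ^ 2 := by linarith
    have j2 : 1 - (x - x0) ^ 2 ≤ 1 := by linarith [sq_nonneg (x - x0)]
    have j3 := mul_nonneg j1 htt
    have j4 := mul_le_mul_of_nonneg_right j2 htt
    simp only [hφ]
    rw [abs_of_nonneg j3]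
    linarith
  have k2 : |-2 * (x - x0) * (t - t0)| ≤ K := by
    rw [abs_mul, abs_mul, abs_of_nonneg htt]; norm_num
    have j5 := mul_le_mul_of_nonneg_right hxa htt
    linarith
  have k3 : |-2 * (t - t0)| ≤ K := by
    rw [abs_le]; constructor <;> linarith
  have k4 : |1 - (x - x0) ^ 2| ≤ K := by
    rw [abs_le]; constructor <;> linarith [sq_nonneg (x - x0)]
  have hp := aux_alg (f := φ (x, t)) (fx := -2 * (x - x0) * (t - t0)) (fxx := -2 * (t - t0))
    (ft := 1 - (x - x0) ^ 2) (l := l) (pxx := pxx (x, t)) (pt := pt (x, t)) (vt := vt (x, t))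
    hA hM hK0 hρ0 hρ1 k1 k2 k3 k4 hvM hG1 hG2
    (by ring) (by ring) hl (by
      simp at hWt; linarith) (by
      simp at hWxx; linarith)
  have hφ2 : φ (x, t) ^ 2 ≤ K ^ 2 := sq_le_sq' (abs_le.1 k1).1 (abs_le.1 k1).2
  have : φ (x, t) ^ 2 * p (x, t) ^ 2 ≤
      K ^ 2 * (K ^ 2 * A + l * (2 * M * A + M ^ 2 * A ^ 2)) := by gcongr
  simp only [hW]
  linarith

/-- partial derivative in the first variable -/
noncomputable def pdX (f : ℝ × ℝ → ℝ) (z : ℝ × ℝ) : ℝ := fderiv ℝ f z (1, 0)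

/-- partial derivative in the second variable -/
noncomputable def pdS (f : ℝ × ℝ → ℝ) (z : ℝ × ℝ) : ℝ := fderiv ℝ f z (0, 1)

lemma pdX_smooth {Ω : Set (ℝ × ℝ)} (hΩ : IsOpen Ω) {f : ℝ × ℝ → ℝ}
    (hf : ContDiffOn ℝ (⊤ : ℕ∞) f Ω) : ContDiffOn ℝ (⊤ : ℕ∞) (pdX f) Ω :=
  (hf.fderiv_of_isOpen hΩ (m := ((⊤ : ℕ∞) : WithTop ℕ∞)) (by simp)).clm_apply contDiffOn_const

lemma pdS_smooth {Ω : Set (ℝ × ℝ)} (hΩ : IsOpen Ω) {f : ℝ × ℝ → ℝ}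
    (hf : ContDiffOn ℝ (⊤ : ℕ∞) f Ω) : ContDiffOn ℝ (⊤ : ℕ∞) (pdS f) Ω :=
  (hf.fderiv_of_isOpen hΩ (m := ((⊤ : ℕ∞) : WithTop ℕ∞)) (by simp)).clm_apply contDiffOn_const

lemma hasDerivAt_pdX {Ω : Set (ℝ × ℝ)} (hΩ : IsOpen Ω) {f : ℝ × ℝ → ℝ}
    (hf : ContDiffOn ℝ (⊤ : ℕ∞) f Ω) {x t : ℝ} (hz : (x, t) ∈ Ω) :
    HasDerivAt (fun y => f (y, t)) (pdX f (x, t)) x := by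
  have h1 : HasFDerivAt f (fderiv ℝ f (x, t)) (x, t) :=
    ((hf.contDiffAt (hΩ.mem_nhds hz)).differentiableAt (by simp)).hasFDerivAt
  exact h1.comp_hasDerivAt (f := fun y : ℝ => (y, t)) x
    ((hasDerivAt_id x).prodMk (hasDerivAt_const x t))

lemma hasDerivAt_pdS {Ω : Set (ℝ × ℝ)} (hΩ : IsOpen Ω) {f : ℝ × ℝ → ℝ}
    (hf : ContDiffOn ℝ (⊤ : ℕ∞) f Ω) {x t : ℝ} (hz : (x, t) ∈ Ω) :
    HasDerivAt (fun s => f (x, s)) (pdS f (x, t)) t := by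
  have h1 : HasFDerivAt f (fderiv ℝ f (x, t)) (x, t) :=
    ((hf.contDiffAt (hΩ.mem_nhds hz)).differentiableAt (by simp)).hasFDerivAt
  exact h1.comp_hasDerivAt (f := fun s : ℝ => (x, s)) t
    ((hasDerivAt_const t x).prodMk (hasDerivAt_id t))

lemma pdXS_comm {Ω : Set (ℝ × ℝ)} (hΩ : IsOpen Ω) {f : ℝ × ℝ → ℝ}
    (hf : ContDiffOn ℝ (⊤ : ℕ∞) f Ω) {z : ℝ × ℝ} (hz : z ∈ Ω) :
    pdX (pdS f) z = pdS (pdX f) z := by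
  have hc : ContDiffAt ℝ (⊤ : ℕ∞) f z := hf.contDiffAt (hΩ.mem_nhds hz)
  have hs : IsSymmSndFDerivAt ℝ f z := hc.isSymmSndFDerivAt (by
    rw [minSmoothness_of_isRCLikeNormedField]
    exact WithTop.coe_le_coe.2 (le_top : (2 : ℕ∞) ≤ ⊤))
  have hd : DifferentiableAt ℝ (fderiv ℝ f) z :=
    (hc.fderiv_right (m := 1)
      (WithTop.coe_le_coe.2 (le_top : (1 + 1 : ℕ∞) ≤ ⊤))).differentiableAt (by simp)
  have e : ∀ a b : ℝ × ℝ, fderiv ℝ (fun w => fderiv ℝ f w a) z b = fderiv ℝ (fderiv ℝ f) z b a := by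
    intro a b
    rw [fderiv_clm_apply hd (by simp)]
    simp
  unfold pdX pdS
  rw [e, e]
  exact hs _ _

lemma hasDerivAt_pdS' {Ω : Set (ℝ × ℝ)} (hΩ : IsOpen Ω) {f : ℝ × ℝ → ℝ}
    (hf : ContDiffOn ℝ (⊤ : ℕ∞) f Ω) {x t : ℝ} (hz : (x, t) ∈ Ω) :
    HasDerivAt (fun y => pdS f (y, t)) (pdS (pdX f) (x, t)) x := by
  have := hasDerivAt_pdX hΩ (pdS_smooth hΩ hf) hz
  rwa [pdXS_comm hΩ hf hz] at this

lemma aux_sq {c C p : ℝ} (hc : 0 < c) (h : c * p ^ 2 ≤ C) : |p| ≤ C / c + 1 := by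
  have h1 : p ^ 2 ≤ C / c := by rw [le_div_iff₀ hc]; linarith
  rw [← sq_abs] at h1
  nlinarith [sq_nonneg (|p| - 1), sq_nonneg (|p|)]

lemma exp_deriv2 (x : ℝ) : HasDerivAt (fun y : ℝ => exp (2 * y)) (2 * exp (2 * x)) x := by
  have := ((hasDerivAt_id x).const_mul 2).exp
  refine this.congr_deriv ?_
  simp; ring

lemma core_eq {κ : ℝ} {Ω : Set (ℝ × ℝ)} (hΩ : IsOpen Ω) {U : ℝ × ℝ → ℝ}
    (hU : ContDiffOn ℝ (⊤ : ℕ∞) U Ω)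
    (hpde : ∀ z ∈ Ω, exp (2 * z.1) * pdS U z = pdX (pdX U) z - κ * sin (2 * U z) / 2) :
    ∀ z ∈ Ω, exp (2 * z.1) * pdS (pdX U) z = pdX (pdX (pdX U)) z
      + (- 2 * pdX (pdX U) z + κ * sin (2 * U z) - κ * cos (2 * U z) * pdX U z) := by
  rintro ⟨x, t⟩ hz
  have hP := pdX_smooth hΩ hU
  have hQ := pdX_smooth hΩ hP
  have d1 := (exp_deriv2 x).mul (hasDerivAt_pdS' hΩ hU hz)
  have d2 := (hasDerivAt_pdX hΩ hQ hz).sub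
    ((((((hasDerivAt_pdX hΩ hU hz).const_mul 2).sin).const_mul κ)).div_const 2)
  have hev : ∀ᶠ y in nhds x, (y, t) ∈ Ω :=
    (Continuous.continuousAt (f := fun y : ℝ => (y, t)) (by fun_prop)).eventually
      (hΩ.mem_nhds hz)
  have d3 := d1.congr_of_eventuallyEq (f₁ := fun y => pdX (pdX U) (y, t) - κ * sin (2 * U (y, t)) / 2)
    (hev.mono fun y hy => (hpde _ hy).symm)
  have := d2.unique d3
  have h0 := hpde _ hz
  simp only at this h0 ⊢
  linarith

lemma core_eq2 {κ : ℝ} {Ω : Set (ℝ × ℝ)} (hΩ : IsOpen Ω) {U : ℝ × ℝ → ℝ}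
    (hU : ContDiffOn ℝ (⊤ : ℕ∞) U Ω)
    (hpde : ∀ z ∈ Ω, exp (2 * z.1) * pdS U z = pdX (pdX U) z - κ * sin (2 * U z) / 2) :
    ∀ z ∈ Ω, exp (2 * z.1) * pdS (pdX (pdX U)) z = pdX (pdX (pdX (pdX U))) z
      + (- 4 * pdX (pdX (pdX U)) z + 4 * pdX (pdX U) z - 2 * κ * sin (2 * U z)
        + 4 * κ * cos (2 * U z) * pdX U z + 2 * κ * sin (2 * U z) * pdX U z ^ 2
        - κ * cos (2 * U z) * pdX (pdX U) z) := by
  rintro ⟨x, t⟩ hz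
  have hP := pdX_smooth hΩ hU
  have hQ := pdX_smooth hΩ hP
  have hR := pdX_smooth hΩ hQ
  have d1 := (exp_deriv2 x).mul (hasDerivAt_pdS' hΩ hP hz)
  have du := (hasDerivAt_pdX hΩ hU hz).const_mul 2
  have d2 := (hasDerivAt_pdX hΩ hR hz).add
    ((((hasDerivAt_pdX hΩ hQ hz).const_mul (-2)).add (du.sin.const_mul κ)).sub
      ((du.cos.const_mul κ).mul (hasDerivAt_pdX hΩ hP hz)))
  have hev : ∀ᶠ y in nhds x, (y, t) ∈ Ω :=
    (Continuous.continuousAt (f := fun y : ℝ => (y, t)) (by fun_prop)).eventually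
      (hΩ.mem_nhds hz)
  have d3 := d1.congr_of_eventuallyEq (f₁ := fun y => pdX (pdX (pdX U)) (y, t)
      + (- 2 * pdX (pdX U) (y, t) + κ * sin (2 * U (y, t)) - κ * cos (2 * U (y, t)) * pdX U (y, t)))
    (hev.mono fun y hy => (core_eq hΩ hU hpde _ hy).symm)
  have := d2.unique d3
  have h0 := core_eq hΩ hU hpde _ hz
  simp only at this h0 ⊢
  linarith

lemma abs_ms {κ s p b : ℝ} (hκ : 0 ≤ κ) (hs : |s| ≤ 1) (hp : |p| ≤ b) : |κ * s * p| ≤ κ * b := by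
  rw [abs_mul, abs_mul, abs_of_nonneg hκ]
  have : κ * |s| ≤ κ * 1 := by gcongr
  rw [mul_one] at this
  gcongr

set_option maxHeartbeats 1000000 in
lemma core_bound {κ B T : ℝ} (hκ : 0 ≤ κ) (hB : 0 ≤ B) (hT : 0 < T) {U : ℝ × ℝ → ℝ}
    (hU : ContDiffOn ℝ (⊤ : ℕ∞) U (Iio 0 ×ˢ Ioo 0 T))
    (hb : ∀ z ∈ Iio (0:ℝ) ×ˢ Ioo 0 T, |U z| ≤ B)
    (hpde : ∀ z ∈ Iio (0:ℝ) ×ˢ Ioo 0 T,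
      exp (2 * z.1) * pdS U z = pdX (pdX U) z - κ * sin (2 * U z) / 2) :
    ∃ C : ℝ, 0 ≤ C ∧ ∀ x < -2, ∀ t ∈ Ico (T / 2) T,
      |pdX U (x, t)| ≤ C ∧ |pdX (pdX U) (x, t)| ≤ C := by
  have hΩ : IsOpen (Iio (0:ℝ) ×ˢ Ioo 0 T) := isOpen_Iio.prod isOpen_Ioo
  have hP := pdX_smooth hΩ hU
  have hQ := pdX_smooth hΩ hP
  have hR := pdX_smooth hΩ hQ
  have e1 := core_eq hΩ hU hpde
  have e2 := core_eq2 hΩ hU hpde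
  have hsub : ∀ x0 < (-1:ℝ), ∀ t0 > (0:ℝ), ∀ t1 < T,
      Icc (x0 - 1) (x0 + 1) ×ˢ Icc t0 t1 ⊆ Iio (0:ℝ) ×ˢ Ioo 0 T := by
    rintro x0 hx0 t0 ht0 t1 ht1 ⟨y, s⟩ ⟨hy, hs⟩
    exact ⟨show y < 0 by linarith [hy.2], lt_of_lt_of_le ht0 hs.1, lt_of_le_of_lt hs.2 ht1⟩
  have hexp : ∀ x : ℝ, x < 0 → exp (2 * x) ≤ 1 := fun x hx => by
    rw [exp_le_one_iff]; linarith
  obtain ⟨C1, hC1, H1⟩ := bernstein_est (κ + 2) B T (by positivity) hB hT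
  set M := C1 / (T / 8) ^ 2 + 1 with hMdef
  have hM0 : 0 ≤ M := by positivity
  have hM : ∀ x < (-1 : ℝ), ∀ t ∈ Ico (T / 4) T, |pdX U (x, t)| ≤ M := by
    intro x hx t ht
    have hs := hsub x hx (T / 8) (by positivity) t ht.2
    have := H1 x (T / 8) t U (pdX U) (pdS U) (pdX (pdX U)) (pdX (pdX (pdX U))) (pdS (pdX U))
      (fun z => exp (2 * z.1)) (by linarith [ht.1]) (by linarith [ht.2])
      (hU.continuousOn.mono hs) (hP.continuousOn.mono hs) (by
        intro y hy s hs'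
        have hz : (y, s) ∈ Iio (0:ℝ) ×ˢ Ioo 0 T := hs ⟨hy, hs'⟩
        refine ⟨hasDerivAt_pdX hΩ hU hz, hasDerivAt_pdX hΩ hP hz, hasDerivAt_pdX hΩ hQ hz,
          hasDerivAt_pdS hΩ hU hz, hasDerivAt_pdS hΩ hP hz, hb _ hz, (exp_pos _).le,
          hexp _ hz.1, ?_, ?_⟩
        · rw [hpde _ hz]
          have a1 := abs_ms (p := 1) hκ (abs_sin_le_one (2 * U (y, s))) (by simp : |(1:ℝ)| ≤ 1)
          have a2 := abs_nonneg (pdX U (y, s))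
          have a3 := mul_nonneg hκ a2
          rw [abs_le] at a1 ⊢
          constructor <;> linarith
        · rw [e1 _ hz]
          have a1 := abs_ms (p := 1) hκ (abs_sin_le_one (2 * U (y, s))) (by simp : |(1:ℝ)| ≤ 1)
          have a4 := abs_ms hκ (abs_cos_le_one (2 * U (y, s))) (le_refl (|pdX U (y, s)|))
          have a2 := abs_nonneg (pdX U (y, s))
          have a5 := abs_nonneg (pdX (pdX U) (y, s))
          have a3 := mul_nonneg hκ a5
          have a6 := le_refl (|pdX (pdX U) (y, s)|)
          rw [abs_le] at a1 a4 ⊢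
          have a7 := abs_le.1 a6
          constructor <;> linarith)
    apply aux_sq (by positivity)
    refine le_trans ?_ this
    have : T / 8 ≤ t - T / 8 := by linarith [ht.1]
    gcongr
  obtain ⟨C2, hC2, H2⟩ := bernstein_est (4 + 3 * κ + 4 * κ * M + 2 * κ * M ^ 2) M T
    (by positivity) hM0 hT
  refine ⟨M + (C2 / (T / 4) ^ 2 + 1), by positivity, ?_⟩
  intro x hx t ht
  constructor
  · have := hM x (by linarith) t ⟨by linarith [ht.1], ht.2⟩
    have : 0 ≤ C2 / (T / 4) ^ 2 + 1 := by positivity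
    linarith
  suffices hh : |pdX (pdX U) (x, t)| ≤ C2 / (T / 4) ^ 2 + 1 by linarith
  have hs := hsub x (by linarith) (T / 4) (by positivity) t ht.2
  have := H2 x (T / 4) t (pdX U) (pdX (pdX U)) (pdS (pdX U)) (pdX (pdX (pdX U)))
      (pdX (pdX (pdX (pdX U)))) (pdS (pdX (pdX U)))
      (fun z => exp (2 * z.1)) (by linarith [ht.1]) (by linarith [ht.2])
      (hP.continuousOn.mono hs) (hQ.continuousOn.mono hs) (by
        intro y hy s hs'
        have hz : (y, s) ∈ Iio (0:ℝ) ×ˢ Ioo 0 T := hs ⟨hy, hs'⟩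
        have hPM : |pdX U (y, s)| ≤ M :=
          hM y (by linarith [hy.2]) s ⟨hs'.1, lt_of_le_of_lt hs'.2 ht.2⟩
        have hPM2 : |pdX U (y, s) ^ 2| ≤ M ^ 2 := by rw [abs_pow]; gcongr
        have a1 := abs_ms (p := 1) hκ (abs_sin_le_one (2 * U (y, s))) (by simp : |(1:ℝ)| ≤ 1)
        have a2 := abs_ms hκ (abs_cos_le_one (2 * U (y, s))) hPM
        have a3 := abs_ms hκ (abs_sin_le_one (2 * U (y, s))) hPM2
        have a4 := abs_ms hκ (abs_cos_le_one (2 * U (y, s))) (le_refl (|pdX (pdX U) (y, s)|))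
        have a5 := abs_le.1 (le_refl (|pdX (pdX U) (y, s)|))
        have a6 := abs_le.1 (le_refl (|pdX (pdX (pdX U)) (y, s)|))
        have n1 := abs_nonneg (pdX (pdX U) (y, s))
        have n2 := abs_nonneg (pdX (pdX (pdX U)) (y, s))
        have m1 : 0 ≤ κ * M := by positivity
        have m2 : 0 ≤ κ * M ^ 2 := by positivity
        have m3 := mul_nonneg hκ n1
        have m4 := mul_nonneg hκ n2
        have m5 := mul_nonneg m1 n1
        have m6 := mul_nonneg m1 n2
        have m7 := mul_nonneg m2 n1
        have m8 := mul_nonneg m2 n2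
        rw [abs_le] at a1 a2 a3 a4
        refine ⟨hasDerivAt_pdX hΩ hP hz, hasDerivAt_pdX hΩ hQ hz, hasDerivAt_pdX hΩ hR hz,
          hasDerivAt_pdS hΩ hP hz, hasDerivAt_pdS hΩ hQ hz, hPM, (exp_pos _).le,
          hexp _ hz.1, ?_, ?_⟩
        · rw [e1 _ hz, abs_le]
          constructor <;> linarith
        · rw [e2 _ hz, abs_le]
          constructor <;> linarith)
  apply aux_sq (by positivity)
  refine le_trans ?_ this
  have : T / 4 ≤ t - T / 4 := by linarith [ht.1]
  gcongr

lemma within_smooth {S : Set (ℝ × ℝ)} (hS : UniqueDiffOn ℝ S) {f : ℝ × ℝ → ℝ}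
    (hf : ContDiffOn ℝ (⊤ : ℕ∞) f S) :
    ContDiffOn ℝ (⊤ : ℕ∞) (fun p => fderivWithin ℝ f S p ((1 : ℝ), (0 : ℝ))) S :=
  (hf.fderivWithin hS (m := ((⊤ : ℕ∞) : WithTop ℕ∞)) (by simp)).clm_apply contDiffOn_const

lemma within_deriv {I J : Set ℝ} {f : ℝ × ℝ → ℝ}
    (hf : ContDiffOn ℝ (⊤ : ℕ∞) f (I ×ˢ J)) {r t : ℝ} (hr : r ∈ I) (ht : t ∈ J) :
    HasDerivWithinAt (fun r' => f (r', t)) (fderivWithin ℝ f (I ×ˢ J) (r, t) (1, 0)) I r := by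
  have h1 : HasFDerivWithinAt f (fderivWithin ℝ f (I ×ˢ J) (r, t)) (I ×ˢ J) (r, t) :=
    ((hf (r, t) ⟨hr, ht⟩).differentiableWithinAt (by simp)).hasFDerivWithinAt
  exact h1.comp_hasDerivWithinAt (f := fun y : ℝ => (y, t)) r
    ((hasDerivWithinAt_id r I).prodMk (hasDerivWithinAt_const r I t)) (fun y hy => ⟨hy, ht⟩)

lemma bound_ext {T C : ℝ} (hT : 0 < T) {G : ℝ × ℝ → ℝ} (m : ℕ) (hC : 0 ≤ C)
    (hG : ContinuousOn G (Ioc (0:ℝ) 1 ×ˢ Ioc (0:ℝ) T))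
    (hb : ∀ x < (-2 : ℝ), ∀ t ∈ Ico (T / 2) T, |exp x ^ m * G (exp x, t)| ≤ C) :
    ∃ C' : ℝ, 0 < C' ∧ ∀ r ∈ Ioc (0:ℝ) 1, ∀ t ∈ Icc (T / 2) T, |G (r, t)| ≤ C' / r ^ m := by
  have hsub : Icc (exp (-3)) 1 ×ˢ Icc (T / 2) T ⊆ Ioc (0:ℝ) 1 ×ˢ Ioc (0:ℝ) T := by
    rintro ⟨r, t⟩ ⟨hr, ht⟩
    exact ⟨⟨lt_of_lt_of_le (exp_pos _) hr.1, hr.2⟩, ⟨by linarith [ht.1], ht.2⟩⟩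
  obtain ⟨C2, hC2⟩ := (isCompact_Icc.prod isCompact_Icc).exists_bound_of_continuousOn (hG.mono hsub)
  refine ⟨C + |C2| + 1, by positivity, ?_⟩
  intro r hr t ht
  have hrm : 0 < r ^ m := pow_pos hr.1 m
  by_cases hr3 : exp (-3) ≤ r
  · have h1 := hC2 (r, t) ⟨⟨hr3, hr.2⟩, ht⟩
    rw [Real.norm_eq_abs] at h1
    rw [le_div_iff₀ hrm]
    have h2 : r ^ m ≤ 1 := pow_le_one₀ hr.1.le hr.2
    have h3 := le_abs_self C2
    have h4 : |G (r, t)| * r ^ m ≤ |G (r, t)| * 1 := by gcongr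
    linarith
  · push Not at hr3
    have hx : log r < -2 := by
      have := (log_lt_log_iff hr.1 (exp_pos _)).2 hr3
      rw [log_exp] at this; linarith
    have hlt : ∀ s ∈ Ico (T / 2) T, |G (r, s)| ≤ C / r ^ m := by
      intro s hs
      have := hb _ hx s hs
      rw [exp_log hr.1, abs_mul, abs_of_pos hrm] at this
      rw [le_div_iff₀ hrm]; linarith
    have hle : C / r ^ m ≤ (C + |C2| + 1) / r ^ m := by
      gcongr
      linarith [abs_nonneg C2]
    refine le_trans ?_ hle
    rcases lt_or_eq_of_le ht.2 with h | h
    · exact hlt t ⟨ht.1, h⟩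
    · subst h
      have hc : ContinuousWithinAt (fun s => G (r, s)) (Ioc 0 t) t :=
        (hG (r, t) ⟨hr, hT, le_rfl⟩).comp
          (Continuous.continuousWithinAt (f := fun s : ℝ => (r, s)) (by fun_prop))
          (fun s hs => ⟨hr, hs⟩)
      have hc2 : ContinuousWithinAt (fun s => G (r, s)) (Ioo 0 t) t :=
        hc.mono Ioo_subset_Ioc_self
      have hc3 := hc2.tendsto.abs
      rw [nhdsWithin_Ioo_eq_nhdsLT hT] at hc3
      refine le_of_tendsto hc3 ?_
      filter_upwards [Ioo_mem_nhdsLT (show t / 2 < t by linarith)] with s hs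
      exact hlt s ⟨hs.1.le, hs.2⟩

/-- Paper's Proposition 3.9 (blow-up rate of `k`-equivariant solutions): if `h` is a bounded
smooth solution of `∂_t h = ∂_r² h + ∂_r h/r − k² sin(2h)/(2r²)` on `(0,1] × (0,T]`, then for
`n ∈ {0,1,2}` one has `|∂_r^n h(r,t)| ≤ C r^{-n}` for `r ∈ (0,1]`, `t ∈ [T/2,T]`. -/
theorem blow_up_rate
    (k : ℕ) (hk : 1 ≤ k) (T B : ℝ) (hT : 0 < T) (hB : 0 ≤ B)
    (h : ℝ × ℝ → ℝ)
    (hsm : ContDiffOn ℝ (⊤ : ℕ∞) h (Ioc (0:ℝ) 1 ×ˢ Ioc (0:ℝ) T))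
    (hbdd : ∀ p ∈ Ioc (0:ℝ) 1 ×ˢ Ioc (0:ℝ) T, |h p| ≤ B)
    (hpde : ∀ p ∈ Ioo (0:ℝ) 1 ×ˢ Ioo (0:ℝ) T,
      pdt h p = pdrr h p + pdr h p / p.1 - (k : ℝ) ^ 2 * sin (2 * h p) / (2 * p.1 ^ 2)) :
    ∀ n : ℕ, n ≤ 2 → ∃ C : ℝ, 0 < C ∧
      ∀ r ∈ Ioc (0:ℝ) 1, ∀ t ∈ Icc (T / 2) T,
        |iteratedDerivWithin n (fun r' => h (r', t)) (Ioc 0 1) r| ≤ C / r ^ n := by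
  set S := Ioc (0:ℝ) 1 ×ˢ Ioc (0:ℝ) T with hSdef
  have hS : UniqueDiffOn ℝ S := (uniqueDiffOn_Ioc 0 1).prod (uniqueDiffOn_Ioc 0 T)
  set H1 : ℝ × ℝ → ℝ := fun p => fderivWithin ℝ h S p ((1 : ℝ), (0 : ℝ)) with hH1
  set H2 : ℝ × ℝ → ℝ := fun p => fderivWithin ℝ H1 S p ((1 : ℝ), (0 : ℝ)) with hH2
  have s1 : ContDiffOn ℝ (⊤ : ℕ∞) H1 S := within_smooth hS hsm
  have s2 : ContDiffOn ℝ (⊤ : ℕ∞) H2 S := within_smooth hS s1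
  have w1 : ∀ r ∈ Ioc (0:ℝ) 1, ∀ t ∈ Ioc (0:ℝ) T,
      HasDerivWithinAt (fun r' => h (r', t)) (H1 (r, t)) (Ioc 0 1) r :=
    fun r hr t ht => within_deriv hsm hr ht
  have w2 : ∀ r ∈ Ioc (0:ℝ) 1, ∀ t ∈ Ioc (0:ℝ) T,
      HasDerivWithinAt (fun r' => H1 (r', t)) (H2 (r, t)) (Ioc 0 1) r :=
    fun r hr t ht => within_deriv s1 hr ht
  have o1 : ∀ r ∈ Ioo (0:ℝ) 1, ∀ t ∈ Ioc (0:ℝ) T,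
      HasDerivAt (fun r' => h (r', t)) (H1 (r, t)) r :=
    fun r hr t ht => (w1 r ⟨hr.1, hr.2.le⟩ t ht).hasDerivAt (Ioc_mem_nhds hr.1 hr.2)
  have o2 : ∀ r ∈ Ioo (0:ℝ) 1, ∀ t ∈ Ioc (0:ℝ) T,
      HasDerivAt (fun r' => H1 (r', t)) (H2 (r, t)) r :=
    fun r hr t ht => (w2 r ⟨hr.1, hr.2.le⟩ t ht).hasDerivAt (Ioc_mem_nhds hr.1 hr.2)
  have i1 : ∀ r ∈ Ioc (0:ℝ) 1, ∀ t ∈ Ioc (0:ℝ) T,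
      iteratedDerivWithin 1 (fun r' => h (r', t)) (Ioc 0 1) r = H1 (r, t) := by
    intro r hr t ht
    rw [iteratedDerivWithin_one]
    exact (w1 r hr t ht).derivWithin (uniqueDiffOn_Ioc 0 1 r hr)
  have i2 : ∀ r ∈ Ioc (0:ℝ) 1, ∀ t ∈ Ioc (0:ℝ) T,
      iteratedDerivWithin 2 (fun r' => h (r', t)) (Ioc 0 1) r = H2 (r, t) := by
    intro r hr t ht
    rw [iteratedDerivWithin_succ]
    rw [derivWithin_congr (f := fun r' => H1 (r', t)) (fun y hy => i1 y hy t ht) (i1 r hr t ht)]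
    exact (w2 r hr t ht).derivWithin (uniqueDiffOn_Ioc 0 1 r hr)
  -- logarithmic variable
  set U : ℝ × ℝ → ℝ := fun z => h (exp z.1, z.2) with hUdef
  have hΩ : IsOpen (Iio (0:ℝ) ×ˢ Ioo 0 T) := isOpen_Iio.prod isOpen_Ioo
  have hexp : ∀ x : ℝ, x < 0 → exp x ∈ Ioo (0:ℝ) 1 := fun x hx => ⟨exp_pos x, by simpa using hx⟩
  have hmaps : MapsTo (fun z : ℝ × ℝ => (exp z.1, z.2)) (Iio (0:ℝ) ×ˢ Ioo 0 T) S := by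
    rintro ⟨x, t⟩ ⟨hx, ht⟩
    exact ⟨Ioo_subset_Ioc_self (hexp x hx), Ioo_subset_Ioc_self ht⟩
  have hU : ContDiffOn ℝ (⊤ : ℕ∞) U (Iio (0:ℝ) ×ˢ Ioo 0 T) := by
    have : ContDiff ℝ (⊤ : ℕ∞) (fun z : ℝ × ℝ => (exp z.1, z.2)) := by fun_prop
    exact hsm.comp this.contDiffOn hmaps
  have hP := pdX_smooth hΩ hU
  have u1 : ∀ x < 0, ∀ t ∈ Ioo 0 T, pdX U (x, t) = exp x * H1 (exp x, t) := by
    intro x hx t ht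
    have d1 := hasDerivAt_pdX hΩ hU (show (x, t) ∈ Iio (0:ℝ) ×ˢ Ioo 0 T from ⟨hx, ht⟩)
    have d2 := (o1 (exp x) (hexp x hx) t (Ioo_subset_Ioc_self ht)).comp x (Real.hasDerivAt_exp x)
    have := d1.unique d2
    rw [this, mul_comm]
  have u2 : ∀ x < 0, ∀ t ∈ Ioo 0 T, pdX (pdX U) (x, t) =
      exp x * H1 (exp x, t) + exp x ^ 2 * H2 (exp x, t) := by
    intro x hx t ht
    have d1 := hasDerivAt_pdX hΩ hP (show (x, t) ∈ Iio (0:ℝ) ×ˢ Ioo 0 T from ⟨hx, ht⟩)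
    have d2 := (Real.hasDerivAt_exp x).mul
      ((o2 (exp x) (hexp x hx) t (Ioo_subset_Ioc_self ht)).comp x (Real.hasDerivAt_exp x))
    have d3 := d2.congr_of_eventuallyEq (f₁ := fun y => pdX U (y, t)) (by
      filter_upwards [Iio_mem_nhds hx] with y hy using u1 y hy t ht)
    have := d1.unique d3
    rw [this]
    simp only [Function.comp]
    ring
  have hUpde : ∀ z ∈ Iio (0:ℝ) ×ˢ Ioo 0 T,
      exp (2 * z.1) * pdS U z = pdX (pdX U) z - (k : ℝ) ^ 2 * sin (2 * U z) / 2 := by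
    rintro ⟨x, t⟩ ⟨hx, ht⟩
    have hr := hexp x hx
    have ht' : t ∈ Ioc 0 T := Ioo_subset_Ioc_self ht
    have h0 := hpde (exp x, t) ⟨hr, ht⟩
    have p1 : pdt h (exp x, t) = pdS U (x, t) :=
      (hasDerivAt_pdS hΩ hU (show (x, t) ∈ Iio (0:ℝ) ×ˢ Ioo 0 T from ⟨hx, ht⟩)).deriv
    have p2 : ∀ r ∈ Ioo (0:ℝ) 1, pdr h (r, t) = H1 (r, t) := fun r hr => (o1 r hr t ht').deriv
    have p3 : pdrr h (exp x, t) = H2 (exp x, t) := by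
      have d := (o2 _ hr t ht').congr_of_eventuallyEq (f₁ := fun r => pdr h (r, t)) (by
        filter_upwards [Ioo_mem_nhds hr.1 hr.2] with y hy using p2 y hy)
      exact d.deriv
    rw [p1, p2 _ hr, p3] at h0
    rw [h0, u2 x hx t ht]
    have he : exp (2 * x) = exp x ^ 2 := by rw [← Real.exp_nat_mul]; norm_num
    simp only [he, hUdef]
    have := (exp_pos x).ne'
    field_simp
    ring
  have hUb : ∀ z ∈ Iio (0:ℝ) ×ˢ Ioo 0 T, |U z| ≤ B := fun z hz => hbdd _ (hmaps hz)
  obtain ⟨C, hC, HC⟩ := core_bound (sq_nonneg (k : ℝ)) hB hT hU hUb hUpde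
  have hI : ∀ t ∈ Icc (T / 2) T, t ∈ Ioc 0 T := fun t ht => ⟨by linarith [ht.1], ht.2⟩
  have hI2 : ∀ t ∈ Ico (T / 2) T, t ∈ Ioo 0 T := fun t ht => ⟨by linarith [ht.1], ht.2⟩
  intro n hn
  interval_cases n
  · refine ⟨B + 1, by positivity, fun r hr t ht => ?_⟩
    have := hbdd (r, t) ⟨hr, hI t ht⟩
    simp only [iteratedDerivWithin_zero, pow_zero, div_one]
    linarith
  · obtain ⟨C', h0, h1⟩ := bound_ext hT (G := H1) 1 hC s1.continuousOn (by
      intro x hx t ht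
      have := (HC x hx t ht).1
      rw [u1 x (by linarith) t (hI2 t ht)] at this
      simpa using this)
    refine ⟨C', h0, fun r hr t ht => ?_⟩
    rw [i1 r hr t (hI t ht)]
    exact h1 r hr t ht
  · obtain ⟨C', h0, h1⟩ := bound_ext hT (G := H2) 2 (show 0 ≤ C + C by linarith)
      s2.continuousOn (by
      intro x hx t ht
      have a1 := (HC x hx t ht).1
      have a2 := (HC x hx t ht).2
      rw [u1 x (by linarith) t (hI2 t ht)] at a1
      rw [u2 x (by linarith) t (hI2 t ht)] at a2
      rw [abs_le] at a1 a2 ⊢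
      constructor <;> linarith)
    refine ⟨C', h0, fun r hr t ht => ?_⟩
    rw [i2 r hr t (hI t ht)]
    exact h1 r hr t ht
end

section
/- Let 0 < T < ∞ and let v : B² × (0,T) → ℝ³ be a map such that v, ∂_t v, the first spatial partial derivatives ∂_{x₁}v, ∂_{x₂}v and the second spatial partial derivatives of v are continuous, |v(x,t)| = 1 everywhere, and ∂_t v = Δv + |∇v|²·v on B² × (0,T), where Δv = ∂²_{x₁}v + ∂²_{x₂}v and |∇v|² = ‖∂_{x₁}v‖² + ‖∂_{x₂}v‖². Assume the finite-energy bound E₀ := sup over t ∈ (0,T) of (1/2)·∫_{B²} |∇v(x,t)|² dx < ∞. Then for every ε > 0, the set of points x₀ ∈ B² such that for every δ > 0 there exists R ∈ (0,δ) with limsup as t → T⁻ of (1/2)·∫_{B_R(x₀) ∩ B²} |∇v(x,t)|² dx > ε, is a finite set. -/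
open Real Set MeasureTheory Metric Filter
open scoped ENNReal

section HMHF
open scoped Topology InnerProductSpace

local notation "XX" => EuclideanSpace ℝ (Fin 2)
local notation "YY" => EuclideanSpace ℝ (Fin 3)

lemma hm_cont {φ f : XX → ℝ} {U : Set XX} (hU : IsOpen U) (hφ : Continuous φ)
    (hs : tsupport φ ⊆ U) (hf : ContinuousOn f U) : Continuous (fun x => φ x * f x) := by
  rw [continuous_iff_continuousAt]
  intro x
  by_cases hx : x ∈ tsupport φ
  · exact hφ.continuousAt.mul (hf.continuousAt (hU.mem_nhds (hs hx)))
  · have h0 : (fun x => φ x * f x) =ᶠ[𝓝 x] fun _ => 0 := by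
      have := notMem_tsupport_iff_eventuallyEq.mp hx
      filter_upwards [this] with y hy
      simp [hy]
    exact (continuousAt_const).congr h0.symm

lemma hm_int {φ f : XX → ℝ} {U : Set XX} (hU : IsOpen U) (hφ : Continuous φ)
    (hc : HasCompactSupport φ)
    (hs : tsupport φ ⊆ U) (hf : ContinuousOn f U) : Integrable (fun x => φ x * f x) :=
  (hm_cont hU hφ hs hf).integrable_of_hasCompactSupport hc.mul_right

lemma hm_ibp {φ : XX → ℝ} {U : Set XX} (hU : IsOpen U) (hφ : ContDiff ℝ 1 φ)
    (hc : HasCompactSupport φ) (hs : tsupport φ ⊆ U) (e : XX) (w a g h : XX → YY)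
    (hw : ∀ x ∈ U, DifferentiableAt ℝ w x ∧ fderiv ℝ w x e = a x)
    (hg : ∀ x ∈ U, DifferentiableAt ℝ g x ∧ fderiv ℝ g x e = h x)
    (ha : ContinuousOn a U) (hh : ContinuousOn h U) :
    ∫ x, φ x * (φ x * ⟪a x, g x⟫_ℝ) =
      - ∫ x, φ x * (φ x * ⟪w x, h x⟫_ℝ + 2 * fderiv ℝ φ x e * ⟪w x, g x⟫_ℝ) := by
  have hwc : ContinuousOn w U := fun x hx => (hw x hx).1.continuousAt.continuousWithinAt
  have hgc : ContinuousOn g U := fun x hx => (hg x hx).1.continuousAt.continuousWithinAt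
  have hφc := hφ.continuous
  have hφd : Continuous (fun x => fderiv ℝ φ x e) :=
    (hφ.continuous_fderiv one_ne_zero).clm_apply continuous_const
  have I1 : Integrable (fun x => φ x * (2 * fderiv ℝ φ x e * ⟪w x, g x⟫_ℝ)) :=
    hm_int hU hφc hc hs (by fun_prop)
  have I2 : Integrable (fun x => φ x * (φ x * (⟪w x, h x⟫_ℝ + ⟪a x, g x⟫_ℝ))) :=
    hm_int hU hφc hc hs (by fun_prop)
  have I3 : Integrable (fun x => φ x * (φ x * ⟪w x, g x⟫_ℝ)) :=
    hm_int hU hφc hc hs (by fun_prop)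
  have I4 : Integrable (fun x => φ x * (φ x * ⟪a x, g x⟫_ℝ)) :=
    hm_int hU hφc hc hs (by fun_prop)
  have I5 : Integrable (fun x => φ x * (φ x * ⟪w x, h x⟫_ℝ)) :=
    hm_int hU hφc hc hs (by fun_prop)
  have key := integral_bilinear_hasLineDerivAt_right_eq_neg_left_of_integrable
    (μ := (volume : Measure XX)) (B := ContinuousLinearMap.mul ℝ ℝ)
    (f := fun x => φ x * φ x) (f' := fun x => 2 * φ x * fderiv ℝ φ x e)
    (g := fun x => ⟪w x, g x⟫_ℝ) (g' := fun x => ⟪w x, h x⟫_ℝ + ⟪a x, g x⟫_ℝ) (v := e)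
    (I1.congr (by filter_upwards with x; simp; ring))
    (I2.congr (by filter_upwards with x; simp; ring))
    (I3.congr (by filter_upwards with x; simp; ring))
    (by
      intro x _
      have h1 := (hφ.differentiable one_ne_zero x).hasFDerivAt
      have := (h1.mul h1).hasLineDerivAt e
      have e3 : 2 * φ x * fderiv ℝ φ x e = (φ x • fderiv ℝ φ x + φ x • fderiv ℝ φ x) e := by
        simp; ring
      rw [e3]
      exact this)
    (by
      intro x hx
      have hxU : x ∈ U := hs (closure_mono (fun y hy => by
        simp only [Function.mem_support] at hy ⊢; exact fun h0 => hy (by simp [h0])) hx)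
      have := ((hw x hxU).1.hasFDerivAt.inner ℝ (hg x hxU).1.hasFDerivAt).hasLineDerivAt e
      convert this using 1
      simp [(hw x hxU).2, (hg x hxU).2])
  simp only [ContinuousLinearMap.mul_apply'] at key
  have e1 : ∫ x, φ x * φ x * (⟪w x, h x⟫_ℝ + ⟪a x, g x⟫_ℝ) =
      (∫ x, φ x * (φ x * ⟪w x, h x⟫_ℝ)) + ∫ x, φ x * (φ x * ⟪a x, g x⟫_ℝ) := by
    rw [← integral_add I5 I4]
    congr 1; ext x; ring
  have e2 : ∫ x, φ x * (φ x * ⟪w x, h x⟫_ℝ + 2 * fderiv ℝ φ x e * ⟪w x, g x⟫_ℝ) =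
      (∫ x, φ x * (φ x * ⟪w x, h x⟫_ℝ)) + ∫ x, 2 * φ x * fderiv ℝ φ x e * ⟪w x, g x⟫_ℝ := by
    rw [← integral_add I5 (I1.congr (by filter_upwards with x; ring))]
    congr 1; ext x; ring
  rw [e2]
  linarith

lemma hm_deriv {φ : XX → ℝ} {U : Set XX} {T : ℝ} (hU : IsOpen U) (hφ : ContDiff ℝ 1 φ)
    (hc : HasCompactSupport φ) (hs : tsupport φ ⊆ U) (e : XX) (v a b d : XX × ℝ → YY)
    (hv : ∀ x ∈ U, ∀ t ∈ Ioo 0 T, DifferentiableAt ℝ (fun y => v (y, t)) x ∧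
      fderiv ℝ (fun y => v (y, t)) x e = a (x, t))
    (ha : ∀ x ∈ U, ∀ t ∈ Ioo 0 T, DifferentiableAt ℝ (fun y => a (y, t)) x ∧
      fderiv ℝ (fun y => a (y, t)) x e = b (x, t))
    (hd : ∀ x ∈ U, ∀ t ∈ Ioo 0 T, HasDerivAt (fun s => v (x, s)) (d (x, t)) t)
    (hca : ContinuousOn a (U ×ˢ Ioo 0 T)) (hcb : ContinuousOn b (U ×ˢ Ioo 0 T))
    (hcd : ContinuousOn d (U ×ˢ Ioo 0 T)) (s : ℝ) (hsT : s ∈ Ioo 0 T) :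
    HasDerivAt (fun t => ∫ x, φ x * (φ x * ‖a (x, t)‖ ^ 2))
      (- ∫ x, φ x * (φ x * ⟪d (x, s), b (x, s) + b (x, s)⟫_ℝ +
        2 * fderiv ℝ φ x e * ⟪d (x, s), a (x, s) + a (x, s)⟫_ℝ)) s := by
  have sl : ∀ {f : XX × ℝ → YY}, ContinuousOn f (U ×ˢ Ioo 0 T) → ∀ t ∈ Ioo 0 T,
      ContinuousOn (fun x => f (x, t)) U := by
    intro f hf t ht
    exact hf.comp (by fun_prop) (fun x hx => ⟨hx, ht⟩)
  have tl : ∀ {f : XX × ℝ → YY}, ContinuousOn f (U ×ˢ Ioo 0 T) → ∀ x ∈ U,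
      ContinuousAt (fun t => f (x, t)) s := by
    intro f hf x hx
    have : ContinuousOn (fun t => f (x, t)) (Ioo 0 T) :=
      hf.comp (by fun_prop) (fun t ht => ⟨hx, ht⟩)
    exact this.continuousAt (isOpen_Ioo.mem_nhds hsT)
  have hvc : ∀ t ∈ Ioo 0 T, ContinuousOn (fun x => v (x, t)) U := fun t ht x hx =>
    (hv x hx t ht).1.continuousAt.continuousWithinAt
  have hφc := hφ.continuous
  have hφd : Continuous (fun x => fderiv ℝ φ x e) :=
    (hφ.continuous_fderiv one_ne_zero).clm_apply continuous_const
  rw [hasDerivAt_iff_tendsto_slope]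
  have hne : ∀ᶠ t in 𝓝[≠] s, t ≠ s := eventually_mem_nhdsWithin
  have hIoo : ∀ᶠ t in 𝓝[≠] s, t ∈ Ioo 0 T := nhdsWithin_le_nhds (isOpen_Ioo.mem_nhds hsT)
  -- the difference quotient, after integration by parts
  have hslope : ∀ᶠ t in 𝓝[≠] s,
      - ∫ x, φ x * (φ x * ⟪slope (fun r => v (x, r)) s t, b (x, t) + b (x, s)⟫_ℝ +
        2 * fderiv ℝ φ x e * ⟪slope (fun r => v (x, r)) s t, a (x, t) + a (x, s)⟫_ℝ) =
      slope (fun t => ∫ x, φ x * (φ x * ‖a (x, t)‖ ^ 2)) s t := by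
    filter_upwards [hne, hIoo] with t hts ht
    have hat := sl hca t ht
    have has := sl hca s hsT
    have hbt := sl hcb t ht
    have hbs := sl hcb s hsT
    have ib := hm_ibp hU hφ hc hs e (fun x => v (x, t) - v (x, s))
      (fun x => a (x, t) - a (x, s)) (fun x => a (x, t) + a (x, s))
      (fun x => b (x, t) + b (x, s))
      (fun x hx => ⟨(hv x hx t ht).1.sub (hv x hx s hsT).1, by
        rw [fderiv_fun_sub (hv x hx t ht).1 (hv x hx s hsT).1]
        simp [(hv x hx t ht).2, (hv x hx s hsT).2]⟩)
      (fun x hx => ⟨(ha x hx t ht).1.add (ha x hx s hsT).1, by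
        rw [fderiv_fun_add (ha x hx t ht).1 (ha x hx s hsT).1]
        simp [(ha x hx t ht).2, (ha x hx s hsT).2]⟩)
      (hat.sub has) (hbt.add hbs)
    have Jt : Integrable (fun x => φ x * (φ x * ‖a (x, t)‖ ^ 2)) :=
      hm_int hU hφc hc hs (hφc.continuousOn.mul (hat.norm.pow 2))
    have Js : Integrable (fun x => φ x * (φ x * ‖a (x, s)‖ ^ 2)) :=
      hm_int hU hφc hc hs (hφc.continuousOn.mul (has.norm.pow 2))
    have e1 : ∫ x, φ x * (φ x * ⟪a (x, t) - a (x, s), a (x, t) + a (x, s)⟫_ℝ) =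
        (∫ x, φ x * (φ x * ‖a (x, t)‖ ^ 2)) - ∫ x, φ x * (φ x * ‖a (x, s)‖ ^ 2) := by
      rw [← integral_sub Jt Js]
      congr 1; ext x
      rw [← real_inner_self_eq_norm_sq, ← real_inner_self_eq_norm_sq, inner_add_right,
        inner_sub_left, inner_sub_left, real_inner_comm (a (x, t)) (a (x, s))]
      ring
    rw [slope_def_field, ← e1, ib, neg_div, ← integral_div]
    congr 2; ext x
    simp only [slope, vsub_eq_sub, real_inner_smul_left]
    rw [inv_eq_one_div]; ring
  refine Tendsto.congr' hslope (Tendsto.neg ?_)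
  -- compact bounds
  obtain ⟨η, hη, hJ⟩ : ∃ η > 0, Icc (s - η) (s + η) ⊆ Ioo 0 T := by
    obtain ⟨η, hη, h⟩ := Metric.nhds_basis_closedBall.mem_iff.mp (isOpen_Ioo.mem_nhds hsT)
    exact ⟨η, hη, by rwa [Real.closedBall_eq_Icc] at h⟩
  have hK : IsCompact (tsupport φ ×ˢ Icc (s - η) (s + η)) := hc.isCompact.prod isCompact_Icc
  have hsub : tsupport φ ×ˢ Icc (s - η) (s + η) ⊆ U ×ˢ Ioo 0 T := prod_mono hs hJ
  obtain ⟨Ma, hMa⟩ := hK.exists_bound_of_continuousOn (hca.mono hsub)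
  obtain ⟨Mb, hMb⟩ := hK.exists_bound_of_continuousOn (hcb.mono hsub)
  obtain ⟨Md, hMd⟩ := hK.exists_bound_of_continuousOn (hcd.mono hsub)
  have hev : ∀ᶠ t in 𝓝[≠] s, t ∈ Icc (s - η) (s + η) :=
    nhdsWithin_le_nhds (Icc_mem_nhds (by linarith) (by linarith))
  have hsJ : s ∈ Icc (s - η) (s + η) := ⟨by linarith, by linarith⟩
  refine tendsto_integral_filter_of_dominated_convergence
    (fun x => |φ x| * (|φ x| * (Md * (Mb + Mb)) + 2 * |fderiv ℝ φ x e| * (Md * (Ma + Ma))))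
    ?_ ?_ ?_ ?_
  · filter_upwards [hne, hIoo] with t hts ht
    have hat := sl hca t ht
    have has := sl hca s hsT
    have hbt := sl hcb t ht
    have hbs := sl hcb s hsT
    have hvt := hvc t ht
    have hvs := hvc s hsT
    refine (hm_cont hU hφc hs ?_).aestronglyMeasurable
    simp only [slope, vsub_eq_sub]
    have hW : ContinuousOn (fun x => (t - s)⁻¹ • (v (x, t) - v (x, s))) U :=
      (hvt.sub hvs).const_smul ((t - s)⁻¹)
    exact (hφc.continuousOn.mul (hW.inner (hbt.add hbs))).add
      ((continuousOn_const.mul hφd.continuousOn).mul (hW.inner (hat.add has)))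
  · filter_upwards [hne, hev] with t hts ht
    refine Eventually.of_forall fun x => ?_
    by_cases hx : x ∈ tsupport φ
    swap
    · simp [image_eq_zero_of_notMem_tsupport hx]
    have hsl : ‖slope (fun r => v (x, r)) s t‖ ≤ Md := by
      have := Convex.norm_image_sub_le_of_norm_hasDerivWithin_le
        (f := fun r => v (x, r)) (f' := fun r => d (x, r)) (s := Icc (s - η) (s + η)) (C := Md)
        (fun r hr => (hd x (hs hx) r (hJ hr)).hasDerivWithinAt)
        (fun r hr => hMd (x, r) ⟨hx, hr⟩) (convex_Icc _ _) hsJ ht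
      rw [slope, norm_smul, norm_inv, vsub_eq_sub, inv_mul_le_iff₀
        (norm_pos_iff.mpr (sub_ne_zero.mpr hts)), mul_comm]
      exact this
    have hb' : ‖b (x, t) + b (x, s)‖ ≤ Mb + Mb :=
      norm_add_le_of_le (hMb _ ⟨hx, ht⟩) (hMb _ ⟨hx, hsJ⟩)
    have ha' : ‖a (x, t) + a (x, s)‖ ≤ Ma + Ma :=
      norm_add_le_of_le (hMa _ ⟨hx, ht⟩) (hMa _ ⟨hx, hsJ⟩)
    have hMd0 : 0 ≤ Md := (norm_nonneg _).trans hsl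
    have i1 : |⟪slope (fun r => v (x, r)) s t, b (x, t) + b (x, s)⟫_ℝ| ≤ Md * (Mb + Mb) :=
      (abs_real_inner_le_norm _ _).trans (by gcongr)
    have i2 : |⟪slope (fun r => v (x, r)) s t, a (x, t) + a (x, s)⟫_ℝ| ≤ Md * (Ma + Ma) :=
      (abs_real_inner_le_norm _ _).trans (by gcongr)
    rw [Real.norm_eq_abs, abs_mul]
    gcongr
    refine (abs_add_le _ _).trans ?_
    simp only [abs_mul, abs_two]
    gcongr
  · have : Integrable (fun x => |φ x| *
      (|φ x| * (Md * (Mb + Mb)) + 2 * |fderiv ℝ φ x e| * (Md * (Ma + Ma)))) := by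
      refine Continuous.integrable_of_hasCompactSupport (by fun_prop) ?_
      exact HasCompactSupport.mul_right (hc.comp_left (g := fun r : ℝ => |r|) abs_zero)
    exact this
  · refine Eventually.of_forall fun x => ?_
    by_cases hx : x ∈ tsupport φ
    swap
    · simp [image_eq_zero_of_notMem_tsupport hx]
    have hd' := hasDerivAt_iff_tendsto_slope.mp (hd x (hs hx) s hsT)
    have hat := (tl hca x (hs hx)).tendsto.mono_left (nhdsWithin_le_nhds (s := {s}ᶜ))
    have hbt := (tl hcb x (hs hx)).tendsto.mono_left (nhdsWithin_le_nhds (s := {s}ᶜ))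
    exact (((hd'.inner (hbt.add_const _)).const_mul _).add
      ((hd'.inner (hat.add_const _)).const_mul _)).const_mul _

lemma hm_lin {f g : XX → ℝ} {U : Set XX} (hU : MeasurableSet U) (c : ℝ) (hc : 0 ≤ c)
    (h0 : ∀ x, x ∉ U → f x = 0) (h1 : ∀ x ∈ U, f x ≤ c * g x) :
    ∫⁻ x, ENNReal.ofReal (f x) ≤ ENNReal.ofReal c * ∫⁻ x in U, ENNReal.ofReal (g x) := by
  rw [← lintegral_const_mul' _ _ ENNReal.ofReal_ne_top, ← lintegral_indicator hU]
  refine lintegral_mono fun x => ?_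
  by_cases hx : x ∈ U
  · rw [indicator_of_mem hx, ← ENNReal.ofReal_mul hc]
    exact ENNReal.ofReal_le_ofReal (h1 x hx)
  · simp [h0 x hx]

lemma hm_limit {φ : XX → ℝ} {U : Set XX} {T : ℝ} (hT : 0 < T) (hU : IsOpen U)
    (hφ : ContDiff ℝ 1 φ)
    (hc : HasCompactSupport φ) (hs : tsupport φ ⊆ U) (e : Fin 2 → XX)
    (v d : XX × ℝ → YY) (a b : Fin 2 → XX × ℝ → YY)
    (hv : ∀ i, ∀ x ∈ U, ∀ t ∈ Ioo 0 T, DifferentiableAt ℝ (fun y => v (y, t)) x ∧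
      fderiv ℝ (fun y => v (y, t)) x (e i) = a i (x, t))
    (ha : ∀ i, ∀ x ∈ U, ∀ t ∈ Ioo 0 T, DifferentiableAt ℝ (fun y => a i (y, t)) x ∧
      fderiv ℝ (fun y => a i (y, t)) x (e i) = b i (x, t))
    (hd : ∀ x ∈ U, ∀ t ∈ Ioo 0 T, HasDerivAt (fun s => v (x, s)) (d (x, t)) t)
    (hca : ∀ i, ContinuousOn (a i) (U ×ˢ Ioo 0 T))
    (hcb : ∀ i, ContinuousOn (b i) (U ×ˢ Ioo 0 T))
    (hcd : ContinuousOn d (U ×ˢ Ioo 0 T))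
    (hsph : ∀ x ∈ U, ∀ t ∈ Ioo 0 T, ‖v (x, t)‖ = 1)
    (hpde : ∀ x ∈ U, ∀ t ∈ Ioo 0 T, d (x, t) = (b 0 (x, t) + b 1 (x, t)) +
      (‖a 0 (x, t)‖ ^ 2 + ‖a 1 (x, t)‖ ^ 2) • v (x, t))
    (A : ℝ≥0∞) (hA : A ≠ ⊤)
    (hen : ∀ t ∈ Ioo 0 T,
      ∫⁻ x in U, ENNReal.ofReal (‖a 0 (x, t)‖ ^ 2 + ‖a 1 (x, t)‖ ^ 2) ≤ A) :
    ∃ L, Tendsto (fun t => ∫ x, φ x * (φ x * (‖a 0 (x, t)‖ ^ 2 + ‖a 1 (x, t)‖ ^ 2)))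
      (𝓝[<] T) (𝓝 L) := by
  have hφc := hφ.continuous
  have sl : ∀ {f : XX × ℝ → YY}, ContinuousOn f (U ×ˢ Ioo 0 T) → ∀ t ∈ Ioo 0 T,
      ContinuousOn (fun x => f (x, t)) U := by
    intro f hf t ht
    exact hf.comp (by fun_prop) (fun x hx => ⟨hx, ht⟩)
  have hφd : ∀ i, Continuous (fun x => fderiv ℝ φ x (e i)) := fun i =>
    (hφ.continuous_fderiv one_ne_zero).clm_apply continuous_const
  have hφdc : ∀ i, HasCompactSupport (fun x => fderiv ℝ φ x (e i)) := fun i =>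
    hc.fderiv_apply ℝ (e i)
  have hφds : ∀ i, tsupport (fun x => fderiv ℝ φ x (e i)) ⊆ U := fun i =>
    (tsupport_fderiv_apply_subset ℝ (e i)).trans hs
  have hMex : ∀ i, ∃ M, ∀ x, ‖fderiv ℝ φ x (e i)‖ ≤ M := fun i =>
    (hφdc i).exists_bound_of_continuous (hφd i)
  choose M hM using hMex
  have HI : ∀ i, ∀ t ∈ Ioo 0 T, Integrable (fun x => fderiv ℝ φ x (e i) *
      (fderiv ℝ φ x (e i) * ‖a i (x, t)‖ ^ 2)) := fun i t ht =>
    hm_int hU (hφd i) (hφdc i) (hφds i)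
      ((hφd i).continuousOn.mul ((sl (hca i) t ht).norm.pow 2))
  have HB : ∀ i, ∀ t ∈ Ioo 0 T, ∫ x, fderiv ℝ φ x (e i) *
      (fderiv ℝ φ x (e i) * ‖a i (x, t)‖ ^ 2) ≤ M i ^ 2 * A.toReal := by
    intro i t ht
    have hnn : ∀ x, 0 ≤ fderiv ℝ φ x (e i) * (fderiv ℝ φ x (e i) * ‖a i (x, t)‖ ^ 2) := by
      intro x; rw [← mul_assoc]; exact mul_nonneg (mul_self_nonneg _) (sq_nonneg _)
    have h1 := ofReal_integral_eq_lintegral_ofReal (HI i t ht) (Eventually.of_forall hnn)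
    have h2 := hm_lin (f := fun x => fderiv ℝ φ x (e i) *
      (fderiv ℝ φ x (e i) * ‖a i (x, t)‖ ^ 2))
      (g := fun x => ‖a 0 (x, t)‖ ^ 2 + ‖a 1 (x, t)‖ ^ 2) hU.measurableSet (M i ^ 2) (sq_nonneg _)
      (fun x hx => by
        have : fderiv ℝ φ x (e i) = 0 :=
          image_eq_zero_of_notMem_tsupport (f := fun x => fderiv ℝ φ x (e i))
            (fun h => hx (hφds i h))
        simp [this])
      (fun x hx => by
        have h3 : fderiv ℝ φ x (e i) ^ 2 ≤ M i ^ 2 := by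
          rw [← sq_abs]
          exact pow_le_pow_left₀ (abs_nonneg _) (hM i x) 2
        have h4 : ‖a i (x, t)‖ ^ 2 ≤ ‖a 0 (x, t)‖ ^ 2 + ‖a 1 (x, t)‖ ^ 2 := by
          fin_cases i
          · simp
          · simp
        rw [← mul_assoc, ← sq]
        gcongr)
    have h5 : ENNReal.ofReal (∫ x, fderiv ℝ φ x (e i) *
      (fderiv ℝ φ x (e i) * ‖a i (x, t)‖ ^ 2)) ≤ ENNReal.ofReal (M i ^ 2 * A.toReal) := by
      rw [h1, ENNReal.ofReal_mul (sq_nonneg _), ENNReal.ofReal_toReal hA]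
      exact h2.trans (by gcongr; exact hen t ht)
    exact (ENNReal.ofReal_le_ofReal_iff (by positivity)).mp h5
  set C : ℝ := 4 * (M 0 ^ 2 * A.toReal + M 1 ^ 2 * A.toReal) with hC
  have hC0 : 0 ≤ C := by positivity
  set E : ℝ → ℝ := fun t => (∫ x, φ x * (φ x * ‖a 0 (x, t)‖ ^ 2)) +
    ∫ x, φ x * (φ x * ‖a 1 (x, t)‖ ^ 2) with hEdef
  have hEeq : ∀ t ∈ Ioo 0 T,
      E t = ∫ x, φ x * (φ x * (‖a 0 (x, t)‖ ^ 2 + ‖a 1 (x, t)‖ ^ 2)) := by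
    intro t ht
    have I : ∀ i, Integrable (fun x => φ x * (φ x * ‖a i (x, t)‖ ^ 2)) := fun i =>
      hm_int hU hφc hc hs (hφc.continuousOn.mul ((sl (hca i) t ht).norm.pow 2))
    rw [hEdef]
    simp only
    rw [← integral_add (I 0) (I 1)]
    congr 1; ext x; ring
  have hEder : ∀ t ∈ Ioo 0 T, ∃ E', HasDerivAt E E' t ∧ E' ≤ C := by
    intro t ht
    have hder := fun i => hm_deriv hU hφ hc hs (e i) v (a i) (b i) d (hv i) (ha i) hd
      (hca i) (hcb i) hcd t ht
    refine ⟨_, (hder 0).add (hder 1), ?_⟩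
    have I : ∀ i, Integrable (fun x => φ x * (φ x * ⟪d (x, t), b i (x, t) + b i (x, t)⟫_ℝ +
        2 * fderiv ℝ φ x (e i) * ⟪d (x, t), a i (x, t) + a i (x, t)⟫_ℝ)) := fun i => by
      have hdt := sl hcd t ht
      have hat := sl (hca i) t ht
      have hbt := sl (hcb i) t ht
      exact hm_int hU hφc hc hs ((hφc.continuousOn.mul (hdt.inner (hbt.add hbt))).add
        ((continuousOn_const.mul (hφd i).continuousOn).mul (hdt.inner (hat.add hat))))
    have hle : ∫ x, -(φ x * (φ x * ⟪d (x, t), b 0 (x, t) + b 0 (x, t)⟫_ℝ +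
          2 * fderiv ℝ φ x (e 0) * ⟪d (x, t), a 0 (x, t) + a 0 (x, t)⟫_ℝ) +
        φ x * (φ x * ⟪d (x, t), b 1 (x, t) + b 1 (x, t)⟫_ℝ +
          2 * fderiv ℝ φ x (e 1) * ⟪d (x, t), a 1 (x, t) + a 1 (x, t)⟫_ℝ)) ≤
        ∫ x, 4 * (fderiv ℝ φ x (e 0) * (fderiv ℝ φ x (e 0) * ‖a 0 (x, t)‖ ^ 2) +
          fderiv ℝ φ x (e 1) * (fderiv ℝ φ x (e 1) * ‖a 1 (x, t)‖ ^ 2)) := by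
      refine integral_mono ((I 0).add (I 1)).neg (((HI 0 t ht).add (HI 1 t ht)).const_mul 4) ?_
      intro x
      simp only
      by_cases hx : x ∈ tsupport φ
      swap
      · rw [image_eq_zero_of_notMem_tsupport hx]
        have : ∀ i, 0 ≤ fderiv ℝ φ x (e i) * (fderiv ℝ φ x (e i) * ‖a i (x, t)‖ ^ 2) := by
          intro i; rw [← mul_assoc]; exact mul_nonneg (mul_self_nonneg _) (sq_nonneg _)
        have h0 := this 0
        have h1 := this 1
        simp only [zero_mul, add_zero, neg_zero]
        positivity
      have hxU := hs hx
      have horth : ⟪d (x, t), v (x, t)⟫_ℝ = 0 := by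
        have h1 := (hd x hxU t ht).norm_sq
        have h2 : HasDerivAt (fun s => ‖v (x, s)‖ ^ 2) 0 t := by
          refine (hasDerivAt_const t (1 : ℝ)).congr_of_eventuallyEq ?_
          filter_upwards [isOpen_Ioo.mem_nhds ht] with s hs'
          simp [hsph x hxU s hs']
        have h3 := h1.unique h2
        rw [real_inner_comm]; linarith
      have hdb : ⟪d (x, t), b 0 (x, t)⟫_ℝ + ⟪d (x, t), b 1 (x, t)⟫_ℝ = ‖d (x, t)‖ ^ 2 := by
        have hb : b 0 (x, t) + b 1 (x, t) = d (x, t) -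
            (‖a 0 (x, t)‖ ^ 2 + ‖a 1 (x, t)‖ ^ 2) • v (x, t) := by
          conv_rhs => rw [hpde x hxU t ht]
          abel
        rw [← inner_add_right, hb, inner_sub_right, real_inner_smul_right, horth,
          real_inner_self_eq_norm_sq]
        ring
      set D := d (x, t)
      set p := φ x
      set r := fderiv ℝ φ x (e 0)
      set s := fderiv ℝ φ x (e 1)
      set y := a 0 (x, t)
      set z := a 1 (x, t)
      have k1 : 0 ≤ ‖p • D + (r • y + s • z)‖ ^ 2 := sq_nonneg _
      have k2 : 0 ≤ ‖r • y - s • z‖ ^ 2 := sq_nonneg _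
      rw [norm_add_sq_real, norm_add_sq_real (r • y)] at k1
      rw [norm_sub_sq_real] at k2
      simp only [inner_add_right, real_inner_smul_left, real_inner_smul_right, norm_smul,
        mul_pow, Real.norm_eq_abs, sq_abs] at k1 k2 ⊢
      nlinarith [k1, k2, congrArg (fun q => p * p * q) hdb]
    rw [integral_neg, integral_add (I 0) (I 1), integral_const_mul,
      integral_add (HI 0 t ht) (HI 1 t ht)] at hle
    have B0 := HB 0 t ht
    have B1 := HB 1 t ht
    rw [hC]
    linarith
  have hanti : AntitoneOn (fun t => E t - C * t) (Ioo 0 T) := by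
    have hder : ∀ t ∈ Ioo 0 T, ∃ E', HasDerivAt (fun t => E t - C * t) E' t ∧ E' ≤ 0 := by
      intro t ht
      obtain ⟨E', h1, h2⟩ := hEder t ht
      refine ⟨_, h1.sub ((hasDerivAt_id t).const_mul C), ?_⟩
      simp; exact h2
    refine antitoneOn_of_deriv_nonpos (convex_Ioo 0 T) ?_ ?_ ?_
    · intro t ht
      obtain ⟨E', h1, h2⟩ := hder t ht
      exact h1.continuousAt.continuousWithinAt
    · rw [interior_Ioo]
      intro t ht
      obtain ⟨E', h1, h2⟩ := hder t ht
      exact h1.differentiableAt.differentiableWithinAt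
    · rw [interior_Ioo]
      intro t ht
      obtain ⟨E', h1, h2⟩ := hder t ht
      rw [h1.deriv]; exact h2
  have hbdd : BddBelow ((fun t => E t - C * t) '' Ioo 0 T) := by
    refine ⟨-(C * T), ?_⟩
    rintro _ ⟨t, ht, rfl⟩
    have h1 : 0 ≤ E t := by
      rw [hEeq t ht]
      refine integral_nonneg fun x => ?_
      simp only [Pi.zero_apply]
      rw [← mul_assoc]
      exact mul_nonneg (mul_self_nonneg _) (by positivity)
    have h2 : C * t ≤ C * T := by gcongr; exact ht.2.le
    simp only
    linarith
  have hlim := hanti.tendsto_nhdsWithin_Ioo_left (nonempty_Ioo.mpr hT) hbdd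
  have hlin : Tendsto (fun t => C * t) (𝓝[<] T) (𝓝 (C * T)) :=
    (Continuous.tendsto (by fun_prop) T).mono_left nhdsWithin_le_nhds
  refine ⟨_, (hlim.add hlin).congr' ?_⟩
  filter_upwards [Ioo_mem_nhdsLT hT] with t ht
  rw [← hEeq t ht]
  ring

end HMHF

/-- Paper's Lemma D.3: for a finite-energy solution `v` of the harmonic map heat flow
`∂_t v = Δv + |∇v|² v` on the unit disc `B² × (0,T)` with values in `S²`, for every `ε > 0`
the set of points of `B²` at which energy more than `ε` concentrates as `t → T⁻` is finite. -/
theorem finitely_many_concentration_points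
    (T : ℝ) (hT : 0 < T)
    (v : EuclideanSpace ℝ (Fin 2) × ℝ → EuclideanSpace ℝ (Fin 3))
    (Dx Dxx : Fin 2 → EuclideanSpace ℝ (Fin 2) × ℝ → EuclideanSpace ℝ (Fin 3))
    (Dt : EuclideanSpace ℝ (Fin 2) × ℝ → EuclideanSpace ℝ (Fin 3))
    (hDx : ∀ i p, Dx i p = fderiv ℝ (fun y => v (y, p.2)) p.1 (EuclideanSpace.single i 1))
    (hDxx : ∀ i p, Dxx i p =
      fderiv ℝ (fun y => fderiv ℝ (fun z => v (z, p.2)) y (EuclideanSpace.single i 1)) p.1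
        (EuclideanSpace.single i 1))
    (hDt : ∀ p, Dt p = deriv (fun s => v (p.1, s)) p.2)
    (hex : ∀ p ∈ (ball (0 : EuclideanSpace ℝ (Fin 2)) 1) ×ˢ Ioo (0:ℝ) T,
      DifferentiableAt ℝ (fun y => v (y, p.2)) p.1 ∧
      (∀ i : Fin 2, DifferentiableAt ℝ
        (fun y => fderiv ℝ (fun z => v (z, p.2)) y (EuclideanSpace.single i 1)) p.1) ∧
      DifferentiableAt ℝ (fun s => v (p.1, s)) p.2)
    (hcv : ContinuousOn v ((ball (0 : EuclideanSpace ℝ (Fin 2)) 1) ×ˢ Ioo (0:ℝ) T))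
    (hcDt : ContinuousOn Dt ((ball (0 : EuclideanSpace ℝ (Fin 2)) 1) ×ˢ Ioo (0:ℝ) T))
    (hcDx : ∀ i, ContinuousOn (Dx i) ((ball (0 : EuclideanSpace ℝ (Fin 2)) 1) ×ˢ Ioo (0:ℝ) T))
    (hcDxx : ∀ i, ContinuousOn (Dxx i) ((ball (0 : EuclideanSpace ℝ (Fin 2)) 1) ×ˢ Ioo (0:ℝ) T))
    (hsph : ∀ p ∈ (ball (0 : EuclideanSpace ℝ (Fin 2)) 1) ×ˢ Ioo (0:ℝ) T, ‖v p‖ = 1)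
    (hpde : ∀ p ∈ (ball (0 : EuclideanSpace ℝ (Fin 2)) 1) ×ˢ Ioo (0:ℝ) T,
      Dt p = (Dxx 0 p + Dxx 1 p) + (‖Dx 0 p‖ ^ 2 + ‖Dx 1 p‖ ^ 2) • v p)
    (E₀ : ℝ≥0∞) (hE₀ : E₀ ≠ ⊤)
    (hen : ∀ t ∈ Ioo (0:ℝ) T,
      2⁻¹ * ∫⁻ x in ball (0 : EuclideanSpace ℝ (Fin 2)) 1,
        ENNReal.ofReal (‖Dx 0 (x, t)‖ ^ 2 + ‖Dx 1 (x, t)‖ ^ 2) ≤ E₀)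
    (ε : ℝ) (hε : 0 < ε) :
    {x₀ : EuclideanSpace ℝ (Fin 2) | x₀ ∈ ball 0 1 ∧
      ∀ δ : ℝ, 0 < δ → ∃ R : ℝ, 0 < R ∧ R < δ ∧
        ENNReal.ofReal ε < Filter.limsup
          (fun t => 2⁻¹ * ∫⁻ x in ball x₀ R ∩ ball (0 : EuclideanSpace ℝ (Fin 2)) 1,
            ENNReal.ofReal (‖Dx 0 (x, t)‖ ^ 2 + ‖Dx 1 (x, t)‖ ^ 2))
          (nhdsWithin T (Iio T))}.Finite := by

  classical
  set U : Set (EuclideanSpace ℝ (Fin 2)) := ball 0 1 with hUdef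
  have hU : IsOpen U := isOpen_ball
  by_contra hinf
  have hinf' := Set.not_finite.mp hinf
  obtain ⟨N, hN⟩ : ∃ N : ℕ, E₀.toReal < N * ε := by
    obtain ⟨N, hN⟩ := exists_nat_gt (E₀.toReal / ε)
    exact ⟨N, by rwa [div_lt_iff₀ hε] at hN⟩
  obtain ⟨F, hFS, hFc⟩ := hinf'.exists_subset_card_eq N
  -- separation of the balls
  have hsep : ∀ᶠ δ : ℝ in nhdsWithin 0 (Ioi 0), 0 < δ ∧ (∀ x ∈ F, ‖x‖ + 2 * δ < 1) ∧
      ∀ x ∈ F, ∀ y ∈ F, x ≠ y → 2 * δ + 2 * δ < dist x y := by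
    refine Eventually.and eventually_mem_nhdsWithin (Eventually.and ?_ ?_)
    · rw [Filter.eventually_all_finset]
      intro x hx
      have hx1 : ‖x‖ < 1 := by simpa [hUdef] using (hFS hx).1
      have : ContinuousAt (fun δ : ℝ => ‖x‖ + 2 * δ) 0 := by fun_prop
      exact nhdsWithin_le_nhds (this.eventually_lt continuousAt_const (by simpa using hx1))
    · rw [Filter.eventually_all_finset]
      intro x hx
      rw [Filter.eventually_all_finset]
      intro y hy
      by_cases hxy : x = y
      · simp [hxy]
      have : ContinuousAt (fun δ : ℝ => 2 * δ + 2 * δ) 0 := by fun_prop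
      filter_upwards [nhdsWithin_le_nhds (this.eventually_lt continuousAt_const
        (show 2 * (0:ℝ) + 2 * 0 < dist x y by
          have := dist_pos.mpr hxy; linarith))] with δ h _ using h
  obtain ⟨δ, hδ, hδ1, hδ2⟩ := hsep.exists
  have hR : ∀ x : EuclideanSpace ℝ (Fin 2), ∃ R : ℝ, 0 < R ∧ R < δ ∧ (x ∈ F →
      ENNReal.ofReal ε < Filter.limsup
          (fun t => 2⁻¹ * ∫⁻ y in ball x R ∩ U,
            ENNReal.ofReal (‖Dx 0 (y, t)‖ ^ 2 + ‖Dx 1 (y, t)‖ ^ 2))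
          (nhdsWithin T (Iio T))) := by
    intro x
    by_cases hx : x ∈ F
    · obtain ⟨R, h1, h2, h3⟩ := (hFS hx).2 δ hδ
      exact ⟨R, h1, h2, fun _ => h3⟩
    · exact ⟨δ / 2, by linarith, by linarith, fun h => absurd h hx⟩
  choose R hR0 hRδ hRl using hR
  let φ : (x : EuclideanSpace ℝ (Fin 2)) → ContDiffBump x := fun x =>
    { rIn := R x, rOut := 2 * R x, rIn_pos := hR0 x, rIn_lt_rOut := by linarith [hR0 x] }
  have hsupp : ∀ x ∈ F, tsupport (φ x) ⊆ U := by
    intro x hx y hy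
    rw [(φ x).tsupport_eq] at hy
    have h1 : dist y x ≤ 2 * R x := hy
    have h2 := hδ1 x hx
    have h3 := hRδ x
    have h4 : ‖y‖ ≤ ‖x‖ + dist y x := by
      rw [dist_eq_norm]
      calc ‖y‖ = ‖x + (y - x)‖ := by congr 1; abel
        _ ≤ _ := norm_add_le _ _
    rw [hUdef, mem_ball_zero_iff]
    linarith
  let A : ℝ≥0∞ := 2 * E₀
  have hA : A ≠ ⊤ := ENNReal.mul_ne_top (by norm_num) hE₀
  have hen' : ∀ t ∈ Ioo 0 T,
      ∫⁻ x in U, ENNReal.ofReal (‖Dx 0 (x, t)‖ ^ 2 + ‖Dx 1 (x, t)‖ ^ 2) ≤ A := by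
    intro t ht
    have := hen t ht
    calc _ = 2 * (2⁻¹ * ∫⁻ x in U, ENNReal.ofReal (‖Dx 0 (x, t)‖ ^ 2 + ‖Dx 1 (x, t)‖ ^ 2)) := by
          rw [← mul_assoc, ENNReal.mul_inv_cancel (by norm_num) (by norm_num), one_mul]
      _ ≤ 2 * E₀ := by gcongr
  let W : EuclideanSpace ℝ (Fin 2) → ℝ → ℝ := fun x t =>
    ∫ y, φ x y * (φ x y * (‖Dx 0 (y, t)‖ ^ 2 + ‖Dx 1 (y, t)‖ ^ 2))
  have hlim : ∀ x ∈ F, ∃ L, Tendsto (W x) (nhdsWithin T (Iio T)) (nhds L) := by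
    intro x hx
    refine hm_limit hT hU (φ x).contDiff (φ x).hasCompactSupport (hsupp x hx)
      (fun i => EuclideanSpace.single i 1) v Dt Dx Dxx ?_ ?_ ?_ hcDx hcDxx hcDt ?_ ?_ A hA hen'
    · intro i y hy t ht
      exact ⟨(hex (y, t) ⟨hy, ht⟩).1, (hDx i (y, t)).symm⟩
    · intro i y hy t ht
      have e1 : (fun z => Dx i (z, t)) =
          fun y => fderiv ℝ (fun z => v (z, t)) y (EuclideanSpace.single i 1) := by
        funext z; exact hDx i (z, t)
      rw [e1]
      exact ⟨(hex (y, t) ⟨hy, ht⟩).2.1 i, (hDxx i (y, t)).symm⟩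
    · intro y hy t ht
      rw [hDt]
      exact (hex (y, t) ⟨hy, ht⟩).2.2.hasDerivAt
    · exact fun y hy t ht => hsph (y, t) ⟨hy, ht⟩
    · exact fun y hy t ht => hpde (y, t) ⟨hy, ht⟩
  have hWlin : ∀ x ∈ F, ∀ t ∈ Ioo 0 T, ENNReal.ofReal (W x t) =
      ∫⁻ y, ENNReal.ofReal (φ x y * (φ x y * (‖Dx 0 (y, t)‖ ^ 2 + ‖Dx 1 (y, t)‖ ^ 2))) := by
    intro x hx t ht
    have sl : ∀ i, ContinuousOn (fun y => Dx i (y, t)) U := fun i =>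
      (hcDx i).comp (by fun_prop) (fun x hx => ⟨hx, ht⟩)
    refine ofReal_integral_eq_lintegral_ofReal (hm_int hU (φ x).continuous
      (φ x).hasCompactSupport (hsupp x hx) ?_) (Eventually.of_forall fun y => ?_)
    · exact (φ x).continuous.continuousOn.mul (((sl 0).norm.pow 2).add ((sl 1).norm.pow 2))
    · have := (φ x).nonneg' y
      simp only [Pi.zero_apply]
      positivity
  have hge : ∀ x ∈ F, ∀ L, Tendsto (W x) (nhdsWithin T (Iio T)) (nhds L) → 2 * ε ≤ L := by
    intro x hx L hL
    refine ge_of_tendsto_of_frequently hL ?_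
    have hfr := frequently_lt_of_lt_limsup (by isBoundedDefault) (hRl x hx)
    refine (hfr.and_eventually (Ioo_mem_nhdsLT hT)).mono ?_
    rintro t ⟨h1, ht⟩
    have h2 : ∫⁻ y in ball x (R x) ∩ U,
        ENNReal.ofReal (‖Dx 0 (y, t)‖ ^ 2 + ‖Dx 1 (y, t)‖ ^ 2) ≤ ENNReal.ofReal (W x t) := by
      rw [hWlin x hx t ht, ← lintegral_indicator (measurableSet_ball.inter hU.measurableSet)]
      refine lintegral_mono fun y => ?_
      by_cases hy : y ∈ ball x (R x) ∩ U
      · have : φ x y = 1 := (φ x).one_of_mem_closedBall (ball_subset_closedBall hy.1)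
        simp [indicator_of_mem hy, this]
      · simp [indicator_of_notMem hy]
    have h3 : ENNReal.ofReal (2 * ε) ≤ ENNReal.ofReal (W x t) := by
      refine le_trans ?_ h2
      calc ENNReal.ofReal (2 * ε) = 2 * ENNReal.ofReal ε := by
            rw [ENNReal.ofReal_mul (by norm_num)]; simp
        _ ≤ 2 * (2⁻¹ * _) := by gcongr
        _ = _ := by
            rw [← mul_assoc, ENNReal.mul_inv_cancel (by norm_num) (by norm_num), one_mul]
    rcases ENNReal.ofReal_le_ofReal_iff'.mp h3 with h | h
    · exact h
    · linarith
  have hW0 : ∀ x t, 0 ≤ W x t := by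
    intro x t
    refine integral_nonneg fun y => ?_
    have := (φ x).nonneg' y
    simp only [Pi.zero_apply]
    positivity
  have hsum : ∀ t ∈ Ioo 0 T, ∑ x ∈ F, W x t ≤ A.toReal := by
    intro t ht
    have h1 : ENNReal.ofReal (∑ x ∈ F, W x t) ≤ A := by
      rw [ENNReal.ofReal_sum_of_nonneg (fun x _ => hW0 x t)]
      calc ∑ x ∈ F, ENNReal.ofReal (W x t) ≤ ∑ x ∈ F, ∫⁻ y in ball x (2 * R x),
            ENNReal.ofReal (‖Dx 0 (y, t)‖ ^ 2 + ‖Dx 1 (y, t)‖ ^ 2) := by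
            refine Finset.sum_le_sum fun x hx => ?_
            rw [hWlin x hx t ht]
            refine (hm_lin (g := fun y => ‖Dx 0 (y, t)‖ ^ 2 + ‖Dx 1 (y, t)‖ ^ 2)
              (U := ball x (2 * R x)) measurableSet_ball 1 zero_le_one ?_ ?_).trans (by simp)
            · intro y hy
              have : φ x y = 0 := (φ x).zero_of_le_dist (not_lt.mp hy)
              simp [this]
            · intro y hy
              have k0 := (φ x).nonneg' y
              have k1 : φ x y ≤ 1 := (φ x).le_one
              rw [← mul_assoc]
              gcongr
              nlinarith
        _ = ∫⁻ y in ⋃ x ∈ F, ball x (2 * R x),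
            ENNReal.ofReal (‖Dx 0 (y, t)‖ ^ 2 + ‖Dx 1 (y, t)‖ ^ 2) := by
            rw [lintegral_biUnion_finset _ (fun _ _ => measurableSet_ball)]
            intro x hx y hy hxy
            have k := hδ2 x hx y hy hxy
            have k1 := hRδ x
            have k2 := hRδ y
            exact ball_disjoint_ball (by linarith)
        _ ≤ ∫⁻ y in U, ENNReal.ofReal (‖Dx 0 (y, t)‖ ^ 2 + ‖Dx 1 (y, t)‖ ^ 2) := by
            refine lintegral_mono_set (iUnion₂_subset fun x hx => ?_)
            refine Subset.trans ?_ (hsupp x hx)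
            rw [(φ x).tsupport_eq]
            exact ball_subset_closedBall
        _ ≤ A := hen' t ht
    exact (ENNReal.ofReal_le_iff_le_toReal hA).mp h1
  choose! L hL using hlim
  have h1 : ∑ x ∈ F, L x ≤ A.toReal := by
    refine le_of_tendsto (tendsto_finsetSum F fun x hx => hL x hx) ?_
    filter_upwards [Ioo_mem_nhdsLT hT] with t ht using hsum t ht
  have h2 : ∑ x ∈ F, 2 * ε ≤ ∑ x ∈ F, L x :=
    Finset.sum_le_sum fun x hx => hge x hx (L x) (hL x hx)
  rw [Finset.sum_const, hFc, nsmul_eq_mul] at h2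
  have h3 : A.toReal = 2 * E₀.toReal := by simp [A]
  linarith
end
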